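/- arXiv:2108.06560 — 6 statements merged into one kernel-verified Lean document; each statement's English description precedes it below -/
import Mathlib

section
/- Let r be the number of indices i ∈ {1, …, g} for which b_i is a root of unity. Then only finitely many partial quotients of the continued fraction of f have degree ≥ r + 2; precisely, the set of convergents (p, q) of f with q monic and ord(p − q f) − deg q ≥ r + 2 is finite. -/
/-- The element `t` of `ℂ((t⁻¹))`: we model `ℂ((t⁻¹))` as the field `LaurentSeries ℂ` of formal
Laurent series in the variable `X = t⁻¹`, so `t` is the inverse of the variable,
i.e. the Hahn series `X⁻¹`. -/
noncomputable def tK : LaurentSeries ℂ := HahnSeries.single (-1 : ℤ) 1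

/-- The embedding `ℂ[t] → ℂ((t⁻¹))`, sending a polynomial `p` to `p(t)`. -/
noncomputable def emb (p : Polynomial ℂ) : LaurentSeries ℂ := Polynomial.aeval tK p

/-- `ord(h)` = the order of vanishing at infinity: for `h = Σ_{n ≤ n₀} c_n tⁿ` nonzero it is
`−max{n : c_n ≠ 0}`, i.e. the Hahn-series order (least exponent of `t⁻¹` in the support),
and `ord 0 = ⊤`. -/
noncomputable def ordE (h : LaurentSeries ℂ) : WithTop ℤ :=
  letI := Classical.propDecidable (h = 0)
  if h = 0 then ⊤ else (h.order : WithTop ℤ)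

/-- `(p, q)` is a convergent of `f`: `p, q` are coprime polynomials, `q ≠ 0`, and
`ord(p − q f) ≥ deg q + 1`. -/
def IsConvergent (f : LaurentSeries ℂ) (p q : Polynomial ℂ) : Prop :=
  q ≠ 0 ∧ IsCoprime p q ∧
    (((q.natDegree : ℤ) + 1 : ℤ) : WithTop ℤ) ≤ ordE (emb p - emb q * f)

open Polynomial in
theorem dvd_eval_of_forall_root {O : Type*} [CommRing O] [IsDomain O] {c : O} {P : O[X]}
    {s : Finset O} (hroot : ∀ t ∈ s, P.eval t = 0) (hdvd : ∀ j, s.card ≤ j → c ∣ P.coeff j)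
    (x : O) : c ∣ P.eval x := by
  rcases eq_or_ne P 0 with rfl | hP
  · simp
  obtain ⟨Q, hQ⟩ : (s.val.map fun a => X - C a).prod ∣ P := by
    rw [Multiset.prod_X_sub_C_dvd_iff_le_roots hP, Multiset.le_iff_subset s.nodup]
    intro t ht
    exact (mem_roots hP).2 (hroot t ht)
  set W := (s.val.map fun a => X - C a).prod with hW
  have hWm : W.Monic := monic_multiset_prod_of_monic _ _ fun a _ => monic_X_sub_C a
  have hWd : W.natDegree = s.card := by
    rw [hW, natDegree_multiset_prod_X_sub_C_eq_card, Finset.card_val]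
  let φ := Ideal.Quotient.mk (Ideal.span {c})
  have hφ : ∀ y, φ y = 0 ↔ c ∣ y := fun y => by
    rw [Ideal.Quotient.eq_zero_iff_mem, Ideal.mem_span_singleton]
  rcases subsingleton_or_nontrivial (O ⧸ Ideal.span {c}) with h | h
  · exact (hφ _).1 (Subsingleton.elim _ _)
  have hQ0 : Q.map φ = 0 := by
    by_contra hne
    have hdeg : (P.map φ).natDegree = s.card + (Q.map φ).natDegree := by
      rw [hQ, Polynomial.map_mul, (hWm.map φ).natDegree_mul' hne, hWm.natDegree_map, hWd]
    have hP0 : P.map φ ≠ 0 := by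
      rw [hQ, Polynomial.map_mul]
      exact fun h0 => hne (by simpa using (hWm.map φ).mul_right_eq_zero_iff.1 h0)
    apply leadingCoeff_ne_zero.2 hP0
    rw [leadingCoeff, coeff_map, hφ]
    exact hdvd _ (by omega)
  rw [← hφ, ← eval₂_hom, ← eval_map, hQ, Polynomial.map_mul, hQ0]
  simp

theorem PadicInt.factorial_dvd_pow (p : ℕ) [hp : Fact p.Prime] (k : ℕ) :
    (k.factorial : ℤ_[p]) ∣ (p : ℤ_[p]) ^ k := by
  obtain ⟨v, w, hw, hvw⟩ :=
    Nat.exists_eq_pow_mul_and_not_dvd k.factorial_ne_zero p hp.out.ne_one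
  have hv : v ≤ k := by
    have h1 := sub_one_mul_padicValNat_factorial (p := p) k
    have h2 : v ≤ padicValNat p k.factorial :=
      (padicValNat_dvd_iff_le k.factorial_ne_zero).1 ⟨w, hvw⟩
    have h3 : 1 ≤ p - 1 := by have := hp.out.two_le; omega
    nlinarith [Nat.sub_le k (p.digits k).sum, Nat.mul_le_mul_right (padicValNat p k.factorial) h3]
  have hu : IsUnit (w : ℤ_[p]) := by
    rw [PadicInt.isUnit_iff]
    exact PadicInt.norm_natCast_eq_one_iff.2 ((Nat.Prime.coprime_iff_not_dvd hp.out).2 hw)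
  rw [hvw]
  push_cast
  exact (hu.mul_right_dvd).2 (pow_dvd_pow _ hv)

open Polynomial in
theorem pow_dvd_sum_mul_pow_of_infinite {p : ℕ} [hp : Fact p.Prime] {O : Type*} [CommRing O]
    [IsDomain O] [CharZero O] [Algebra ℤ_[p] O] {J : Type*} [Fintype J] (e z : J → O)
    (hinf : {u : ℕ | ∑ j, e j * (1 + p ^ 2 * z j) ^ u = 0}.Infinite) (k m : ℕ) :
    (p : O) ^ k ∣ ∑ j, e j * (1 + p ^ 2 * z j) ^ m := by
  have hfac : ∀ i : ℕ, ∃ h : O, (i.factorial : O) * h = (p : O) ^ i := fun i => by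
    obtain ⟨h, hh⟩ := PadicInt.factorial_dvd_pow p i
    refine ⟨algebraMap _ O h, ?_⟩
    have := congrArg (algebraMap ℤ_[p] O) hh
    simpa using this.symm
  choose h hh using hfac
  let c : ℕ → O := fun i => (∑ j, e j * z j ^ i) * h i
  let R : ℕ → O[X] := fun n =>
    ∑ i ∈ Finset.range (n + 1), C (p ^ i * c i) * descPochhammer O i
  have hR : ∀ n u, u ≤ n → (R n).eval (u : O) = ∑ j, e j * (1 + p ^ 2 * z j) ^ u := by
    intro n u hun
    have key : ∀ i, eval (u : O) (C (p ^ i * c i) * descPochhammer O i) =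
        ∑ j, e j * ((p ^ 2 * z j) ^ i * (u.choose i : O)) := by
      intro i
      rw [eval_mul, eval_C, descPochhammer_eval_eq_descFactorial,
        Nat.descFactorial_eq_factorial_mul_choose]
      push_cast
      calc _ = (p : O) ^ i * (i.factorial * h i) * (u.choose i) * ∑ j, e j * z j ^ i := by
            simp only [c]; ring
        _ = _ := by
            rw [hh, Finset.mul_sum]
            refine Finset.sum_congr rfl fun j _ => ?_
            ring
    simp only [R, eval_finsetSum, key]
    rw [Finset.sum_comm]
    refine Finset.sum_congr rfl fun j _ => ?_
    rw [← Finset.mul_sum, add_comm (1 : O), add_pow]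
    congr 1
    symm
    refine (Finset.sum_subset (Finset.range_mono (by omega : u + 1 ≤ n + 1)) ?_).trans
      (Finset.sum_congr rfl fun i _ => by simp)
    intro i _ hi
    rw [Finset.mem_range, not_lt] at hi
    simp [Nat.choose_eq_zero_of_lt (show u < i by omega)]
  obtain ⟨s, hs, hcard⟩ := hinf.exists_subset_card_eq k
  have hinj : Function.Injective (Nat.cast : ℕ → O) := Nat.cast_injective
  let n := max m (s.sup id)
  rw [← hR n m (le_max_left _ _)]
  refine dvd_eval_of_forall_root (s := s.map ⟨_, hinj⟩) ?_ ?_ _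
  · intro t ht
    obtain ⟨u, hu, rfl⟩ := Finset.mem_map.1 ht
    exact (hR n u ((Finset.le_sup (f := id) hu).trans (le_max_right _ _))).trans (hs hu)
  · intro j hj
    rw [Finset.card_map, hcard] at hj
    simp only [R, finsetSum_coeff, coeff_C_mul]
    refine Finset.dvd_sum fun i _ => ?_
    rcases le_or_gt j i with hij | hij
    · exact ((pow_dvd_pow _ (hj.trans hij)).mul_right _).mul_right _
    · rw [coeff_eq_zero_of_natDegree_lt (by rwa [descPochhammer_natDegree]), mul_zero]
      exact dvd_zero _

open Cardinal in
theorem PadicInt.continuum_le_mk (p : ℕ) [Fact p.Prime] : 𝔠 ≤ #ℤ_[p] := by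
  have h := continuum_le_cardinal_of_isOpen (E := ℚ_[p]) ℚ_[p]
    (Metric.isOpen_ball (x := 0) (ε := 1)) ⟨0, by simp⟩
  refine h.trans (mk_le_of_injective (f := fun x => (⟨x.1, ?_⟩ : ℤ_[p])) ?_)
  · simpa using (mem_ball_zero_iff.1 x.2).le
  · intro x y hxy
    exact Subtype.ext (congrArg (fun z : ℤ_[p] => (z : ℚ_[p])) hxy)

open Cardinal in
theorem PadicInt.exists_algebraicIndependent (p : ℕ) [Fact p.Prime] (T : Type) (hT : #T ≤ 𝔠) :
    ∃ σ : T → ℤ_[p], AlgebraicIndependent ℤ σ := by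
  obtain ⟨s, hs⟩ := exists_isTranscendenceBasis ℤ ℤ_[p]
  have := hs.isAlgebraic
  have h1 := Algebra.IsAlgebraic.cardinalMk_le_max
    (Algebra.adjoin ℤ (Set.range (Subtype.val : s → ℤ_[p]))) ℤ_[p]
  rw [← Cardinal.mk_congr hs.1.aevalEquiv.toEquiv] at h1
  have h2 : #(MvPolynomial s ℤ) ≤ max (max ℵ₀ #s) ℵ₀ := by
    simpa using MvPolynomial.cardinalMk_le_max (σ := s) (R := ℤ)
  have h3 : 𝔠 ≤ max (max (max ℵ₀ #s) ℵ₀) ℵ₀ :=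
    (PadicInt.continuum_le_mk p).trans (h1.trans (max_le_max_right _ h2))
  have h4 : 𝔠 ≤ #s := by
    simpa [le_max_iff, not_le.2 aleph0_lt_continuum] using h3
  obtain ⟨i⟩ := Cardinal.le_def _ _ |>.1 (hT.trans h4)
  exact ⟨_, hs.1.comp i i.injective⟩

open Cardinal in
theorem exists_ringHom_forall_isIntegral (S : Finset ℂ) :
    ∃ (p : ℕ) (_ : Fact p.Prime) (φ : ℂ →+* AlgebraicClosure ℚ_[p]),
      ∀ x ∈ S, IsIntegral ℤ_[p] (φ x) := by
  obtain ⟨T, x, hx⟩ := exists_isTranscendenceBasis' ℤ ℂ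
  have hT : #T ≤ 𝔠 := mk_complex ▸ mk_le_of_injective hx.1.injective
  let A := MvPolynomial T ℤ
  let : Algebra A ℂ := (MvPolynomial.aeval x).toRingHom.toAlgebra
  have hAinj : Function.Injective (algebraMap A ℂ) := hx.1
  have hAalg : Algebra.IsAlgebraic A ℂ := by
    refine ⟨fun y => ?_⟩
    have := hx.isAlgebraic.1 y
    exact this.of_ringHom_of_comp_eq (R := A) hx.1.aevalEquiv.toRingEquiv.toRingHom (RingHom.id ℂ)
      hx.1.aevalEquiv.surjective Function.injective_id
      (MvPolynomial.ringHom_ext (by simp) fun t => by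
        change ((hx.1.aevalEquiv (MvPolynomial.X t) : _) : ℂ) =
          MvPolynomial.aeval x (MvPolynomial.X t)
        simp)
  obtain ⟨c, hc0, hc⟩ : ∃ c : A, c ≠ 0 ∧ ∀ x ∈ S, IsIntegral A (c • x) :=
    Algebra.IsAlgebraic.exists_integral_multiples A S
  obtain ⟨a, ha⟩ : ∃ a : T → ℤ, MvPolynomial.eval a c ≠ 0 := by
    by_contra! h
    exact hc0 (MvPolynomial.funext (by simpa using h))
  obtain ⟨p, hpc, hp⟩ := Nat.exists_infinite_primes ((MvPolynomial.eval a c).natAbs + 1)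
  have : Fact p.Prime := ⟨hp⟩
  obtain ⟨σ, hσ⟩ := PadicInt.exists_algebraicIndependent p T hT
  let P : T → Polynomial ℤ := fun t => Polynomial.C (a t) + Polynomial.C (p : ℤ) * Polynomial.X
  have hP : ∀ t, Transcendental ℤ (P t) := by
    intro t
    have hp0 : (p : ℤ) ≠ 0 := by exact_mod_cast hp.ne_zero
    have hPt : P t = Polynomial.C (p : ℤ) * Polynomial.X + Polynomial.C (a t) := add_comm _ _
    apply Polynomial.transcendental
    · rw [hPt, Polynomial.natDegree_linear hp0]
      exact one_ne_zero
    · rw [hPt, Polynomial.leadingCoeff_linear hp0]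
      exact mem_nonZeroDivisors_of_ne_zero hp0
  have hτ := hσ.polynomial_aeval_of_transcendental hP
  set τ : T → ℤ_[p] := fun t => Polynomial.aeval (σ t) (P t) with hτdef
  let ev : A →+* ℤ_[p] := (MvPolynomial.aeval τ).toRingHom
  have hunit : IsUnit (ev c) := by
    have hmod : (PadicInt.toZMod (ev c) : ZMod p) = ((MvPolynomial.eval a c : ℤ) : ZMod p) := by
      have : (PadicInt.toZMod (p := p)).comp ev =
          (Int.castRingHom (ZMod p)).comp (MvPolynomial.eval a) := by
        ext t
        · simp
        · simp [ev, τ, P]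
      exact congrArg (fun h : A →+* ZMod p => h c) this
    by_contra hu
    rw [← mem_nonunits_iff, ← IsLocalRing.mem_maximalIdeal, ← PadicInt.ker_toZMod,
      RingHom.mem_ker, hmod, ZMod.intCast_zmod_eq_zero_iff_dvd, Int.natCast_dvd] at hu
    exact absurd (Nat.le_of_dvd (Int.natAbs_pos.2 ha) hu) (by omega)
  let Ω := AlgebraicClosure ℚ_[p]
  let : Algebra A Ω := ((algebraMap ℤ_[p] Ω).comp ev).toAlgebra
  have hZΩ : Function.Injective (algebraMap ℤ_[p] Ω) := by
    rw [IsScalarTower.algebraMap_eq ℤ_[p] ℚ_[p] Ω]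
    exact (algebraMap ℚ_[p] Ω).injective.comp (IsFractionRing.injective ℤ_[p] ℚ_[p])
  have hΩinj : Function.Injective (algebraMap A Ω) :=
    hZΩ.comp hτ
  have : Module.IsTorsionFree A ℂ := Module.isTorsionFree_iff_algebraMap_injective.2 hAinj
  have : Module.IsTorsionFree A Ω := Module.isTorsionFree_iff_algebraMap_injective.2 hΩinj
  let φ : ℂ →ₐ[A] Ω := IsAlgClosed.lift
  refine ⟨p, inferInstance, φ.toRingHom, fun y hy => ?_⟩
  have h1 : IsIntegral A (φ (c • y)) := (hc y hy).map φ
  have h2 : IsIntegral ℤ_[p] (φ (c • y)) :=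
    h1.map_of_comp_eq ev (RingHom.id Ω) rfl
  obtain ⟨u, hu⟩ := hunit
  have h3 : φ y = algebraMap ℤ_[p] Ω (↑u⁻¹) * φ (c • y) := by
    rw [Algebra.smul_def, map_mul, φ.commutes]
    change _ = _ * (algebraMap ℤ_[p] Ω (ev c) * _)
    rw [← hu, ← mul_assoc, ← map_mul, Units.inv_mul, map_one, one_mul]
  change IsIntegral ℤ_[p] (φ y)
  rw [h3]
  exact isIntegral_algebraMap.mul h2

theorem exists_arithmeticProgression_of_infinite_zeros {J : Type*} [Fintype J] (e ω : J → ℂ)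
    (hω : ∀ j, ω j ≠ 0) (hinf : {u : ℕ | ∑ j, e j * ω j ^ u = 0}.Infinite) :
    ∃ a L : ℕ, 0 < L ∧ ∀ m : ℕ, ∑ j, e j * ω j ^ (a + L * m) = 0 := by
  classical
  obtain ⟨p, hp, φ, hφ⟩ := exists_ringHom_forall_isIntegral
    (Finset.univ.image e ∪ Finset.univ.image ω ∪ Finset.univ.image fun j => (ω j)⁻¹)
  let Ω := AlgebraicClosure ℚ_[p]
  have hZΩ : Function.Injective (algebraMap ℤ_[p] Ω) := by
    rw [IsScalarTower.algebraMap_eq ℤ_[p] ℚ_[p] Ω]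
    exact (algebraMap ℚ_[p] Ω).injective.comp (IsFractionRing.injective ℤ_[p] ℚ_[p])
  let G : Set Ω := φ '' ↑(Finset.univ.image e ∪ Finset.univ.image ω ∪
    Finset.univ.image fun j => (ω j)⁻¹)
  let O := Algebra.adjoin ℤ_[p] G
  have hGe : ∀ j, φ (e j) ∈ O := fun j => Algebra.subset_adjoin ⟨_, by simp, rfl⟩
  have hGω : ∀ j, φ (ω j) ∈ O := fun j => Algebra.subset_adjoin ⟨_, by simp, rfl⟩
  have hGi : ∀ j, φ (ω j)⁻¹ ∈ O := fun j => Algebra.subset_adjoin ⟨_, by simp, rfl⟩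
  let E : J → O := fun j => ⟨_, hGe j⟩
  let W : J → O := fun j => ⟨_, hGω j⟩
  let V : J → O := fun j => ⟨_, hGi j⟩
  have hVW : ∀ j, V j * W j = 1 := fun j => Subtype.ext <| by
    change φ (ω j)⁻¹ * φ (ω j) = 1
    rw [← map_mul, inv_mul_cancel₀ (hω j), map_one]
  have hfin : Module.Finite ℤ_[p] O := Algebra.finite_adjoin_of_finite_of_isIntegral
    ((Finset.finite_toSet _).image _) (by rintro _ ⟨x, hx, rfl⟩; exact hφ x hx)
  have hnoeth : IsNoetherianRing O := IsNoetherianRing.of_finite ℤ_[p] O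
  have hZO : Function.Injective (algebraMap ℤ_[p] O) := fun x y h =>
    hZΩ (congrArg Subtype.val h)
  have hchar : CharZero O := charZero_of_injective_algebraMap hZO
  have hfs : FaithfulSMul ℤ_[p] O := (faithfulSMul_iff_algebraMap_injective _ _).2 hZO
  let I : Ideal ℤ_[p] := Ideal.span {(p : ℤ_[p]) ^ 2}
  have hIfin : Finite (ℤ_[p] ⧸ I) := by
    have : NeZero (p ^ 2) := ⟨pow_ne_zero _ hp.out.ne_zero⟩
    have hk : I = RingHom.ker (PadicInt.toZModPow (p := p) 2) :=
      (PadicInt.ker_toZModPow (p := p) 2).symm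
    rw [hk]
    exact Finite.of_injective _ (RingHom.kerLift_injective (PadicInt.toZModPow (p := p) 2))
  have hQfin : Finite (O ⧸ I • (⊤ : Submodule ℤ_[p] O)) := by
    have : Finite (O ⧸ (⊤ : Submodule ℤ_[p] O)) := inferInstance
    exact Submodule.finite_quotient_smul I hfin.fg_top
  obtain ⟨L, hL, hLW⟩ : ∃ L : ℕ, 0 < L ∧ ∀ j, ∃ z : O, W j ^ L = 1 + p ^ 2 * z := by
    obtain ⟨n, m, hnm, hne⟩ := Function.not_injective_iff.1 (not_injective_infinite_finite
      fun (n : ℕ) (j : J) => (I • (⊤ : Submodule ℤ_[p] O)).mkQ (W j ^ n))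
    wlog hlt : m < n generalizing n m
    · exact this m n hnm.symm hne.symm (by omega)
    refine ⟨n - m, by omega, fun j => ?_⟩
    have h1 := congrFun hnm j
    simp only [Submodule.mkQ_apply] at h1
    rw [Submodule.Quotient.eq, Submodule.ideal_span_singleton_smul,
      Submodule.mem_smul_pointwise_iff_exists] at h1
    obtain ⟨z, -, hz⟩ := h1
    refine ⟨V j ^ m * z, ?_⟩
    have hz' : (p : O) ^ 2 * z = W j ^ n - W j ^ m := by
      rw [← hz, Algebra.smul_def]
      simp
    obtain ⟨k, rfl⟩ := Nat.exists_eq_add_of_lt hlt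
    have hVm : V j ^ m * W j ^ m = 1 := by rw [← mul_pow, hVW, one_pow]
    rw [show m + k + 1 - m = k + 1 by omega]
    rw [show m + k + 1 = m + (k + 1) by omega, pow_add] at hz'
    linear_combination (-V j ^ m) * hz' - (W j ^ (k + 1) - 1) * hVm
  choose z hz using hLW
  have hsum : ∀ u, φ (∑ j, e j * ω j ^ u) = ((∑ j, E j * W j ^ u : O) : Ω) := fun u => by
    simp [E, W, map_sum]
  obtain ⟨a, ha⟩ : ∃ a, {m : ℕ | ∑ j, e j * ω j ^ (a + L * m) = 0}.Infinite := by
    by_contra! h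
    refine hinf (((Finset.range L).finite_toSet.biUnion fun a _ =>
      (h a).image fun m => a + L * m).subset ?_)
    intro u hu
    refine Set.mem_biUnion (x := u % L) (by simpa using Nat.mod_lt _ hL) ⟨u / L, ?_, ?_⟩
    · simpa [Nat.mod_add_div] using hu
    · exact Nat.mod_add_div _ _
  refine ⟨a, L, hL, fun m => ?_⟩
  have hsum' : ∀ m, φ (∑ j, e j * ω j ^ (a + L * m)) =
      ((∑ j, (E j * W j ^ a) * (1 + p ^ 2 * z j) ^ m : O) : Ω) := fun m => by
    rw [hsum]
    congr 1
    refine Finset.sum_congr rfl fun j _ => ?_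
    rw [← hz, pow_add, pow_mul, mul_assoc]
  have hpn : ¬ IsUnit (p : O) := by
    have h1 : ¬ IsUnit (p : ℤ_[p]) := PadicInt.prime_p.not_isUnit
    rwa [← isUnit_map_iff (algebraMap ℤ_[p] O), map_natCast] at h1
  have hdvd := fun k => pow_dvd_sum_mul_pow_of_infinite (p := p) (fun j => E j * W j ^ a) z
    (ha.mono fun m hm => by
      have := hsum' m
      rw [show ∑ j, e j * ω j ^ (a + L * m) = 0 from hm, map_zero] at this
      exact Subtype.ext this.symm) k m
  have hbot := Ideal.iInf_pow_eq_bot_of_isDomain (Ideal.span {(p : O)})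
    (by rwa [Ne, Ideal.span_singleton_eq_top])
  have hmem : ∑ j, (E j * W j ^ a) * (1 + p ^ 2 * z j) ^ m ∈ ⨅ i, Ideal.span {(p : O)} ^ i := by
    rw [Ideal.mem_iInf]
    intro k
    rw [Ideal.span_singleton_pow, Ideal.mem_span_singleton]
    exact hdvd k
  rw [hbot, Ideal.mem_bot] at hmem
  apply φ.injective
  rw [hsum', hmem, map_zero]
  rfl

theorem exists_addMonoidHom_rat_forall_ne_zero {G ι : Type*} [AddCommGroup G] [Finite ι]
    (v : ι → G) (hv : ∀ i, ∀ m : ℤ, m ≠ 0 → m • v i ≠ 0) :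
    ∃ ψ : G →+ ℚ, ∀ i, ψ (v i) ≠ 0 := by
  have hf : ∀ i, TensorProduct.mk ℤ ℚ G 1 (v i) ≠ 0 := fun i h => by
    obtain ⟨m, hm⟩ :=
      (IsLocalizedModule.eq_zero_iff (nonZeroDivisors ℤ) (TensorProduct.mk ℤ ℚ G 1)).1 h
    exact hv i m (nonZeroDivisors.ne_zero m.2) hm
  obtain ⟨ψ, hψ⟩ := Module.exists_dual_forall_apply_ne_zero (K := ℚ) _ hf
  exact ⟨ψ.toAddMonoidHom.comp (TensorProduct.mk ℤ ℚ G 1).toAddMonoidHom, hψ⟩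

open Polynomial in
theorem eq_zero_of_forall_sum_mul_pow_eq_zero {J K : Type*} [Fintype J] [Field K] (e w : J → K)
    (h : ∀ m : ℕ, ∑ j, e j * w j ^ m = 0) {j₀ : J} (hj : ∀ j, w j = w j₀ → j = j₀) :
    e j₀ = 0 := by
  classical
  have key : ∀ Q : K[X], ∑ j, e j * Q.eval (w j) = 0 := fun Q => by
    simp_rw [eval_eq_sum_range, Finset.mul_sum]
    rw [Finset.sum_comm]
    refine Finset.sum_eq_zero fun i _ => ?_
    rw [← mul_zero (Q.coeff i), ← h i, Finset.mul_sum]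
    exact Finset.sum_congr rfl fun j _ => by ring
  have h0 := key (∏ j ∈ Finset.univ.erase j₀, (X - C (w j)))
  rw [Finset.sum_eq_single j₀ (fun j _ hne => ?_) (by simp)] at h0
  · refine (mul_eq_zero.1 h0).resolve_right ?_
    rw [eval_prod]
    refine Finset.prod_ne_zero_iff.2 fun j hjm h1 => ?_
    rw [eval_sub, eval_X, eval_C, sub_eq_zero] at h1
    exact Finset.ne_of_mem_erase hjm (hj j h1.symm)
  · rw [eval_prod, Finset.prod_eq_zero (Finset.mem_erase.2 ⟨hne, Finset.mem_univ j⟩) (by simp),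
      mul_zero]

theorem Finset.eq_filter_pos_of_sum_eq {ι : Type*} [Fintype ι] [DecidableEq ι] {v : ι → ℚ}
    (hv : ∀ i, v i ≠ 0) {I : Finset ι}
    (h : ∑ i ∈ I, v i = ∑ i ∈ Finset.univ.filter (fun i => 0 < v i), v i) :
    I = Finset.univ.filter (fun i => 0 < v i) := by
  have h1 : ∑ i, ((if 0 < v i then v i else 0) - if i ∈ I then v i else 0) = 0 := by
    rw [Finset.sum_sub_distrib, ← Finset.sum_filter, ← Finset.sum_filter, ← h]
    simp
  rw [Finset.sum_eq_zero_iff_of_nonneg] at h1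
  · ext i
    have h2 := h1 i (Finset.mem_univ i)
    have h3 := hv i
    simp only [Finset.mem_filter, Finset.mem_univ, true_and]
    by_cases hI : i ∈ I <;> by_cases hp : 0 < v i <;> simp_all
  · intro i _
    by_cases hI : i ∈ I <;> by_cases hp : 0 < v i <;> simp [hI, hp]
    · exact not_lt.1 hp
    · exact hp.le

theorem det_pow_mul_vandermonde_sub {R : Type*} [CommRing R] {s : ℕ} (c c' x : Fin s → R) :
    (Matrix.of fun i (j : Fin s) => x i * c i ^ (j : ℕ) - c' i ^ (j : ℕ)).det =
      ∑ I : Finset (Fin s), (∏ i, if i ∈ I then 1 else -1) *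
        (Matrix.vandermonde fun i => if i ∈ I then c i else c' i).det * ∏ i ∈ I, x i := by
  have h1 : (Matrix.of fun i (j : Fin s) => x i * c i ^ (j : ℕ) - c' i ^ (j : ℕ)) =
      (fun i (j : Fin s) => x i * c i ^ (j : ℕ)) + fun i (j : Fin s) => -(c' i ^ (j : ℕ)) := by
    ext i j
    simp [sub_eq_add_neg]
  have h2 := (Matrix.detRowAlternating (n := Fin s) (R := R)).toMultilinearMap.map_add_univ
    (fun i (j : Fin s) => x i * c i ^ (j : ℕ)) fun i (j : Fin s) => -(c' i ^ (j : ℕ))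
  rw [h1]
  refine h2.trans (Finset.sum_congr rfl fun I _ => ?_)
  have h3 : (I.piecewise (fun i (j : Fin s) => x i * c i ^ (j : ℕ)) fun i (j : Fin s) =>
      -(c' i ^ (j : ℕ))) = Matrix.of fun i j => (if i ∈ I then x i else -1) *
        Matrix.vandermonde (fun i => if i ∈ I then c i else c' i) i j := by
    ext i j
    by_cases hi : i ∈ I <;> simp [hi, Matrix.vandermonde_apply]
  have h4 : (∏ i, if i ∈ I then x i else -1) =
      (∏ i, if i ∈ I then 1 else -1) * ∏ i ∈ I, x i := by
    rw [← Fintype.prod_ite_mem I x, ← Finset.prod_mul_distrib]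
    exact Finset.prod_congr rfl fun i _ => by split_ifs <;> simp
  change Matrix.det (I.piecewise _ _) = _
  rw [h3, Matrix.det_mul_column, h4]
  ring

open Polynomial in
theorem finite_setOf_exists_polynomial_eval_inv {s : ℕ} (c : Fin s → ℂ) (h0 : ∀ i, c i ≠ 0)
    (hinj : Function.Injective c) (hinv : ∀ i j, c i ≠ (c j)⁻¹)
    (hroot : ∀ i, ∀ m : ℕ, 0 < m → c i ^ m ≠ 1) :
    {M : ℕ | ∃ W : ℂ[X], W ≠ 0 ∧ W.natDegree < s ∧
      ∀ i, W.eval (c i) * c i ^ (2 * M) = W.eval (c i)⁻¹}.Finite := by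
  by_contra hinf
  let e : Finset (Fin s) → ℂ := fun I => (∏ i, if i ∈ I then 1 else -1) *
    (Matrix.vandermonde fun i => if i ∈ I then c i else (c i)⁻¹).det
  let u : Fin s → ℂˣ := fun i => Units.mk0 (c i) (h0 i)
  let ω : Finset (Fin s) → ℂˣ := fun I => ∏ i ∈ I, u i ^ 2
  have he : ∀ I, e I ≠ 0 := by
    intro I
    refine mul_ne_zero (Finset.prod_ne_zero_iff.2 fun i _ => by split_ifs <;> simp) ?_
    rw [Matrix.det_vandermonde_ne_zero_iff]
    intro i j hij
    dsimp only at hij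
    split_ifs at hij
    · exact hinj hij
    · exact absurd hij (hinv i j)
    · exact absurd hij.symm (hinv j i)
    · exact hinj (inv_injective hij)
  have hzero : {M : ℕ | ∑ I, e I * (ω I : ℂ) ^ M = 0}.Infinite := by
    refine Set.Infinite.mono ?_ hinf
    rintro M ⟨W, hW0, hWs, hW⟩
    have hdet : (Matrix.of fun i (j : Fin s) =>
        c i ^ (2 * M) * c i ^ (j : ℕ) - (c i)⁻¹ ^ (j : ℕ)).det = 0 := by
      rw [← Matrix.exists_mulVec_eq_zero_iff]
      refine ⟨fun j => W.coeff j, fun h => hW0 ?_, ?_⟩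
      · ext n
        rcases lt_or_ge n s with hn | hn
        · exact congrFun h ⟨n, hn⟩
        · exact coeff_eq_zero_of_natDegree_lt (hWs.trans_le hn)
      · ext i
        have h1 := hW i
        rw [eval_eq_sum_range' hWs, eval_eq_sum_range' hWs, ← sub_eq_zero] at h1
        rw [Pi.zero_apply, ← h1, ← Fin.sum_univ_eq_sum_range (fun j => W.coeff j * c i ^ j),
          ← Fin.sum_univ_eq_sum_range (fun j => W.coeff j * (c i)⁻¹ ^ j), Finset.sum_mul,
          ← Finset.sum_sub_distrib]
        simp only [Matrix.mulVec, dotProduct, Matrix.of_apply]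
        exact Finset.sum_congr rfl fun j _ => by ring
    rw [det_pow_mul_vandermonde_sub c (fun i => (c i)⁻¹) fun i => c i ^ (2 * M)] at hdet
    refine Eq.trans (Finset.sum_congr rfl fun I _ => ?_) hdet
    simp only [e, ω, u, Units.coe_prod, Units.val_pow_eq_pow_val, Units.val_mk0,
      ← Finset.prod_pow, ← pow_mul]
  obtain ⟨a, L, hL, hsum⟩ := exists_arithmeticProgression_of_infinite_zeros e (fun I => (ω I : ℂ))
    (fun I => (ω I).ne_zero) hzero
  obtain ⟨ψ, hψ⟩ := exists_addMonoidHom_rat_forall_ne_zero (fun i => Additive.ofMul (u i))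
    fun i m hm h => by
      have h1 : u i ^ m.natAbs = 1 := pow_natAbs_eq_one.2 (Additive.ofMul.injective h)
      exact hroot i _ (Int.natAbs_pos.2 hm) (by simpa [u] using congrArg Units.val h1)
  set v : Fin s → ℚ := fun i => ψ (Additive.ofMul (u i)) with hv
  have hψω : ∀ I, ψ (Additive.ofMul (ω I ^ L)) = L * (2 * ∑ i ∈ I, v i) := fun I => by
    simp [ω, hv, ofMul_pow, ofMul_prod, map_sum, Finset.mul_sum]
  have := eq_zero_of_forall_sum_mul_pow_eq_zero (fun I => e I * (ω I : ℂ) ^ a)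
    (fun I => (ω I : ℂ) ^ L) (fun m => by
      rw [← hsum m]
      exact Finset.sum_congr rfl fun I _ => by rw [pow_add, pow_mul, mul_assoc])
    (j₀ := Finset.univ.filter fun i => 0 < v i) fun I hI => by
      refine Finset.eq_filter_pos_of_sum_eq hψ ?_
      have h1 : ω I ^ L = ω (Finset.univ.filter fun i => 0 < v i) ^ L :=
        Units.ext (by simpa using hI)
      have h2 := congrArg (fun y => ψ (Additive.ofMul y)) h1
      simp only [hψω] at h2
      have hL' : (L : ℚ) ≠ 0 := by exact_mod_cast hL.ne'
      exact mul_left_cancel₀ two_ne_zero (mul_left_cancel₀ hL' h2)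
  exact mul_ne_zero (he _) (pow_ne_zero _ (ω _).ne_zero) this

open Polynomial in
theorem exists_eval_eq_pow_mul_eval_half_add_inv {h : ℂ[X]} {M : ℕ} (hM : h.natDegree ≤ M) :
    ∃ H : ℂ[X], H.natDegree ≤ 2 * M ∧ H.eval 0 = h.coeff M / 2 ^ M ∧
      ∀ x, x ≠ 0 → H.eval x = x ^ M * h.eval ((x + x⁻¹) / 2) := by
  refine ⟨∑ j ∈ Finset.range (M + 1),
    C (h.coeff j / 2 ^ j) * ((X ^ 2 + 1) ^ j * X ^ (M - j)), ?_, ?_, fun x hx => ?_⟩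
  · refine natDegree_sum_le_of_forall_le _ _ fun j hj => ?_
    have hj' : j ≤ M := Nat.lt_succ_iff.1 (Finset.mem_range.1 hj)
    have h1 : (X ^ 2 + 1 : ℂ[X]).natDegree ≤ 2 := by compute_degree
    refine (natDegree_C_mul_le _ _).trans (natDegree_mul_le.trans ?_)
    have h2 := natDegree_pow_le_of_le j h1
    have h3 := natDegree_X_pow_le (R := ℂ) (M - j)
    lia
  · rw [eval_finsetSum, Finset.sum_eq_single M]
    · simp
    · intro j hj hne
      have : M - j ≠ 0 := by have := Finset.mem_range.1 hj; lia
      simp [this]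
    · simp
  · rw [eval_finsetSum, eval_eq_sum_range' (Nat.lt_succ_of_le hM), Finset.mul_sum]
    refine Finset.sum_congr rfl fun j hj => ?_
    have hj' : j ≤ M := Nat.lt_succ_iff.1 (Finset.mem_range.1 hj)
    obtain ⟨m, rfl⟩ := Nat.exists_eq_add_of_le hj'
    have h1 : (x + x⁻¹) / 2 * x = (x ^ 2 + 1) / 2 := by field_simp
    have h2 : x ^ j * ((x + x⁻¹) / 2) ^ j = (x ^ 2 + 1) ^ j / 2 ^ j := by
      rw [← mul_pow, mul_comm x, h1, div_pow]
    simp only [eval_mul, eval_C, eval_pow, eval_add, eval_X, eval_one, Nat.add_sub_cancel_left]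
    rw [pow_add]
    linear_combination (-h.coeff j * x ^ m) * h2

open Polynomial in
theorem exists_eval_eq_pow_mul_half_sub_inv_mul_eval {Q : ℂ[X]} {M : ℕ}
    (hQ : Q.natDegree + 1 ≤ M) :
    ∃ U : ℂ[X], U.natDegree ≤ 2 * M ∧ U.eval 0 = -(Q.coeff (M - 1) / 2 ^ M) ∧
      ∀ x, x ≠ 0 → U.eval x = x ^ M * ((x - x⁻¹) / 2 * Q.eval ((x + x⁻¹) / 2)) := by
  obtain ⟨m, rfl⟩ := Nat.exists_eq_add_of_le' ((Nat.le_add_left 1 _).trans hQ)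
  obtain ⟨T, hTd, hT0, hTe⟩ :=
    exists_eval_eq_pow_mul_eval_half_add_inv (Nat.le_of_add_le_add_right hQ)
  refine ⟨C (1 / 2) * ((X ^ 2 - 1) * T), ?_, ?_, fun x hx => ?_⟩
  · have h1 : (X ^ 2 - 1 : ℂ[X]).natDegree ≤ 2 := by compute_degree
    refine (natDegree_C_mul_le _ _).trans (natDegree_mul_le.trans ?_)
    lia
  · simp only [eval_mul, eval_C, eval_sub, eval_pow, eval_X, eval_one, hT0, Nat.add_sub_cancel,
      pow_succ]
    ring
  · simp only [eval_mul, eval_C, eval_sub, eval_pow, eval_X, eval_one, hTe x hx, pow_succ]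
    linear_combination (x ^ m * eval ((x + x⁻¹) / 2) Q / 2) * mul_inv_cancel₀ hx

open Polynomial in
theorem exists_eval_mul_pow_eq_eval_inv {p Q N : ℂ[X]} {M k : ℕ} (hM : 1 ≤ M)
    (hp : p.natDegree ≤ M) (hQ : Q.natDegree + 1 ≤ M) (hN : p ^ 2 - (X ^ 2 - 1) * Q ^ 2 = N)
    (hN0 : N ≠ 0) (hk : N.natDegree ≤ k) (hkM : k ≤ M)
    (hlead : p.coeff M + Q.coeff (M - 1) ≠ 0) :
    ∃ W : ℂ[X], W ≠ 0 ∧ W.natDegree ≤ k ∧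
      ∀ b, b ≠ 0 → Q.eval ((b + b⁻¹) / 2) = 0 → W.eval b * b ^ (2 * (M - k)) = W.eval b⁻¹ := by
  obtain ⟨P, hPd, hP0, hPe⟩ := exists_eval_eq_pow_mul_eval_half_add_inv hp
  obtain ⟨U, hUd, hU0, hUe⟩ := exists_eval_eq_pow_mul_half_sub_inv_mul_eval hQ
  obtain ⟨Z, -, -, hZe⟩ := exists_eval_eq_pow_mul_eval_half_add_inv hk
  have hprod : (P - U) * (P + U) = X ^ (2 * M - k) * Z := by
    refine eq_of_infinite_eval_eq _ _ (Set.Infinite.mono (s := {0}ᶜ) (fun x hx => ?_)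
      (Set.finite_singleton (0 : ℂ)).infinite_compl)
    have hx : x ≠ 0 := hx
    have h1 : (2 * M - k) + k = 2 * M := by lia
    have h2 : x ^ (2 * M - k) * x ^ k = (x ^ M) ^ 2 := by rw [← pow_add, h1]; ring
    have h3 : x * x⁻¹ = 1 := mul_inv_cancel₀ hx
    simp only [Set.mem_ofPred_eq, eval_mul, eval_sub, eval_add, eval_pow, eval_X, hPe x hx,
      hUe x hx, hZe x hx, ← hN, eval_one]
    rw [← mul_assoc (x ^ (2 * M - k)), h2]
    linear_combination ((x ^ M) ^ 2 * Q.eval ((x + x⁻¹) / 2) ^ 2) * h3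
  have hX : ¬ (X : ℂ[X]) ∣ P - U := by
    rw [X_dvd_iff, coeff_zero_eq_eval_zero, eval_sub, hP0, hU0, sub_neg_eq_add, ← add_div]
    exact div_ne_zero hlead (pow_ne_zero _ two_ne_zero)
  have hdvd : X ^ (2 * M - k) ∣ P + U :=
    prime_X.pow_dvd_of_dvd_mul_left _ hX (Dvd.intro _ hprod.symm)
  obtain ⟨W, hW⟩ := hdvd
  have hZ : Z ≠ 0 := fun hZ => by
    refine hN0 (Polynomial.funext fun y => ?_)
    obtain ⟨β, hβ⟩ := IsAlgClosed.exists_pow_nat_eq (y ^ 2 - 1) two_pos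
    have h1 : (y + β) * (y - β) = 1 := by linear_combination -hβ
    have h2 := left_ne_zero_of_mul_eq_one h1
    have h3 := hZe _ h2
    rw [← eq_inv_of_mul_eq_one_right h1, hZ, eval_zero, eq_comm, mul_eq_zero,
      add_add_sub_cancel, add_self_div_two] at h3
    rw [h3.resolve_left (pow_ne_zero _ h2), eval_zero]
  have hW0 : W ≠ 0 := fun h => by
    rw [hW, h, mul_zero, mul_zero, eq_comm, mul_eq_zero] at hprod
    exact hprod.elim (pow_ne_zero _ X_ne_zero) hZ
  refine ⟨W, hW0, ?_, fun b hb hQb => ?_⟩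
  · have h1 : (P + U).natDegree ≤ 2 * M := natDegree_add_le_of_degree_le hPd hUd
    rw [hW, natDegree_mul (pow_ne_zero _ X_ne_zero) hW0, natDegree_X_pow] at h1
    lia
  · have hb' := inv_ne_zero hb
    have hQb' : Q.eval ((b⁻¹ + b⁻¹⁻¹) / 2) = 0 := by rwa [inv_inv, add_comm]
    have e1 := congrArg (eval b) hW
    have e2 := congrArg (eval b⁻¹) hW
    rw [eval_mul, eval_pow, eval_X, eval_add, hPe _ hb, hUe _ hb, hQb, mul_zero, mul_zero,
      add_zero] at e1
    rw [eval_mul, eval_pow, eval_X, eval_add, hPe _ hb', hUe _ hb', hQb', mul_zero, mul_zero,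
      add_zero, inv_inv, add_comm b⁻¹] at e2
    have h1 : 2 * M - k = M + (M - k) := by lia
    rw [h1, pow_add, mul_assoc] at e1 e2
    have e3 := (mul_left_cancel₀ (pow_ne_zero _ hb) e1).symm.trans
      (mul_left_cancel₀ (pow_ne_zero _ hb') e2)
    rw [two_mul, pow_add, ← mul_assoc, mul_comm (W.eval b), e3, mul_right_comm, ← mul_pow,
      inv_mul_cancel₀ hb, one_pow, one_mul]

theorem ordE_eq_orderTop (h : LaurentSeries ℂ) : ordE h = h.orderTop := by
  unfold ordE
  split_ifs with h0
  · rw [h0, HahnSeries.orderTop_zero]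
  · exact HahnSeries.order_eq_orderTop_of_ne_zero h0

theorem emb_eq_sum (P : Polynomial ℂ) :
    emb P = ∑ i ∈ Finset.range (P.natDegree + 1), HahnSeries.single (-(i : ℤ)) (P.coeff i) := by
  rw [emb, Polynomial.aeval_eq_sum_range]
  refine Finset.sum_congr rfl fun i _ => ?_
  rw [tK, HahnSeries.single_pow, Algebra.smul_def, LaurentSeries.algebraMap_apply,
    HahnSeries.C_apply, HahnSeries.single_mul_single]
  simp

theorem orderTop_emb {P : Polynomial ℂ} (hP : P ≠ 0) :
    (emb P).orderTop = ((-(P.natDegree : ℤ) : ℤ) : WithTop ℤ) := by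
  refine le_antisymm (HahnSeries.orderTop_le_of_coeff_ne_zero ?_)
    (HahnSeries.le_orderTop_iff_forall.2 fun m hm => ?_)
  · rw [emb_eq_sum, HahnSeries.coeff_sum, Finset.sum_eq_single P.natDegree]
    · simpa using hP
    · intro i _ hi
      exact HahnSeries.coeff_single_of_ne (by simpa using hi.symm)
    · simp
  · rw [WithTop.coe_lt_coe] at hm
    rw [emb_eq_sum, HahnSeries.coeff_sum]
    refine Finset.sum_eq_zero fun i hi => HahnSeries.coeff_single_of_ne ?_
    have := Finset.mem_range.1 hi
    lia

theorem emb_mul (P Q : Polynomial ℂ) : emb (P * Q) = emb P * emb Q := map_mul _ P Q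

theorem emb_sub (P Q : Polynomial ℂ) : emb (P - Q) = emb P - emb Q := map_sub _ P Q

theorem emb_pow (P : Polynomial ℂ) (n : ℕ) : emb (P ^ n) = emb P ^ n := map_pow _ P n

theorem eq_of_isConvergent_of_natDegree_eq {f : LaurentSeries ℂ} {p q p' q' : Polynomial ℂ}
    (h : IsConvergent f p q) (h' : IsConvergent f p' q') (hq : q.Monic) (hq' : q'.Monic)
    (hd : q.natDegree = q'.natDegree) : p = p' ∧ q = q' := by
  obtain ⟨hq0, hpq, ho⟩ := h
  obtain ⟨hq0', hpq', ho'⟩ := h'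
  rw [ordE_eq_orderTop] at ho ho'
  have hcross : p * q' - q * p' = 0 := by
    by_contra hne
    have h1 : emb (p * q' - q * p') =
        emb q' * (emb p - emb q * f) - emb q * (emb p' - emb q' * f) := by
      simp only [emb_sub, emb_mul]
      ring
    have h2 : ∀ P R : Polynomial ℂ, P ≠ 0 → R.natDegree = P.natDegree → ∀ h : LaurentSeries ℂ,
        (((R.natDegree : ℤ) + 1 : ℤ) : WithTop ℤ) ≤ h.orderTop →
        ((1 : ℤ) : WithTop ℤ) ≤ (emb P * h).orderTop := fun P R hP hR h hh => by
      rw [HahnSeries.orderTop_mul, orderTop_emb hP]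
      refine le_trans ?_ (add_le_add_right hh _)
      rw [← WithTop.coe_add, WithTop.coe_le_coe]
      lia
    have h3 := (le_min (h2 q' q hq0' hd _ ho) (h2 q q' hq0 hd.symm _ ho')).trans
      HahnSeries.min_orderTop_le_orderTop_sub
    rw [← h1, orderTop_emb hne, WithTop.coe_le_coe] at h3
    lia
  have hdvd : q ∣ q' := hpq.symm.dvd_of_dvd_mul_left (Dvd.intro _ (sub_eq_zero.1 hcross).symm)
  have hqq := Polynomial.eq_of_monic_of_dvd_of_natDegree_le hq hq' hdvd hd.ge
  subst hqq
  rw [mul_comm _ p'] at hcross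
  exact ⟨mul_right_cancel₀ hq0' (sub_eq_zero.1 hcross), rfl⟩

theorem natDegree_of_le_orderTop_sub {f : LaurentSeries ℂ} {p q D : Polynomial ℂ} {d δ : ℕ}
    (hf : f ^ 2 = emb D) (hD : D ≠ 0) (hd : D.natDegree = 2 * d) (hq : q ≠ 0)
    (h : (((q.natDegree : ℤ) + δ : ℤ) : WithTop ℤ) ≤ (emb p - emb q * f).orderTop)
    (hδ : 1 ≤ δ) (hN : p ^ 2 - D * q ^ 2 ≠ 0) :
    p.natDegree = q.natDegree + d ∧ (p ^ 2 - D * q ^ 2).natDegree + δ ≤ d := by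
  have hfo : f.orderTop = ((-(d : ℤ) : ℤ) : WithTop ℤ) := by
    have h1 := congrArg HahnSeries.orderTop hf
    rw [sq, HahnSeries.orderTop_mul, orderTop_emb hD, hd] at h1
    cases ho : f.orderTop with
    | top =>
      rw [ho, top_add] at h1
      exact (WithTop.top_ne_coe h1).elim
    | coe a =>
      rw [ho, ← WithTop.coe_add, WithTop.coe_inj] at h1
      rw [WithTop.coe_inj]
      push_cast at h1
      lia
  have hqf : (emb q * f).orderTop = ((-((q.natDegree : ℤ) + d) : ℤ) : WithTop ℤ) := by
    rw [HahnSeries.orderTop_mul, orderTop_emb hq, hfo, ← WithTop.coe_add, neg_add]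
  have hlt : (emb q * f).orderTop < (emb p - emb q * f).orderTop := by
    refine lt_of_lt_of_le ?_ h
    rw [hqf, WithTop.coe_lt_coe]
    lia
  have hpo : (emb p).orderTop = (emb q * f).orderTop := by
    rw [← HahnSeries.orderTop_add_eq_right hlt, sub_add_cancel]
  have hp : p ≠ 0 := fun hp => by
    rw [hqf, hp, emb, map_zero, HahnSeries.orderTop_zero] at hpo
    exact WithTop.top_ne_coe hpo
  constructor
  · rw [orderTop_emb hp, hqf, WithTop.coe_inj] at hpo
    lia
  · have h1 : emb (p ^ 2 - D * q ^ 2) = (emb p - emb q * f) * (emb p + emb q * f) := by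
      rw [emb_sub, emb_mul, emb_pow, emb_pow, ← hf]
      ring
    have h2 : (emb q * f).orderTop ≤ (emb p + emb q * f).orderTop :=
      (le_min hpo.ge le_rfl).trans HahnSeries.min_orderTop_le_orderTop_add
    have h3 := add_le_add h h2
    rw [← HahnSeries.orderTop_mul, ← h1, orderTop_emb hN, hqf, ← WithTop.coe_add,
      WithTop.coe_le_coe] at h3
    lia

open Polynomial in
theorem sq_sub_X_sq_sub_one_mul_sq_ne_zero {p A : ℂ[X]} (hA : A ≠ 0) :
    p ^ 2 - (X ^ 2 - 1) * A ^ 2 ≠ 0 := by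
  intro h
  have h1 : p ^ 2 = (X - C 1) * ((X + C 1) * A ^ 2) := by
    rw [sub_eq_zero.1 h, C_1]
    ring
  have hX : (X + C 1 : ℂ[X]) ≠ 0 := X_add_C_ne_zero 1
  have h2 : (X + C 1) * A ^ 2 ≠ 0 := mul_ne_zero hX (pow_ne_zero _ hA)
  have h3 : rootMultiplicity 1 (X + C 1 : ℂ[X]) = 0 := by
    refine rootMultiplicity_eq_zero ?_
    simp only [IsRoot, eval_add, eval_X, eval_C]
    norm_num
  have hp : p ≠ 0 := fun hp => by
    rw [hp, zero_pow two_ne_zero, eq_comm] at h1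
    exact mul_ne_zero (X_sub_C_ne_zero 1) h2 h1
  have h4 := congrArg (rootMultiplicity 1) h1
  rw [rootMultiplicity_mul (mul_ne_zero (X_sub_C_ne_zero 1) h2), rootMultiplicity_mul h2, h3,
    rootMultiplicity_X_sub_C_self, sq, sq, rootMultiplicity_mul (mul_ne_zero hp hp),
    rootMultiplicity_mul (mul_ne_zero hA hA)] at h4
  lia

/-- Only finitely many partial quotients of `√D` have degree `≥ r + 2`, where `r` is the number
of the `b_i` which are roots of unity. -/
theorem stmt10 (g : ℕ) (hg : 1 ≤ g) (ρ β b : Fin g → ℂ)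
    (hρdist : Function.Injective ρ) (hρ1 : ∀ i, ρ i ≠ 1 ∧ ρ i ≠ -1)
    (hβ : ∀ i, β i ^ 2 = ρ i ^ 2 - 1) (hbdef : ∀ i, b i = ρ i + β i)
    (hbinj : Function.Injective b) (hbInv : ∀ i j, b i ≠ (b j)⁻¹)
    (D₁ D : Polynomial ℂ)
    (hD₁ : D₁ = ∏ i, (Polynomial.X - Polynomial.C (ρ i)))
    (hD : D = (Polynomial.X ^ 2 - 1) * D₁ ^ 2)
    (d : ℕ) (hd : d = g + 1)
    (f : LaurentSeries ℂ) (hf2 : f ^ 2 = emb D) (hlead : f.coeff (-(d : ℤ)) = 1)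
    (r : ℕ) (hr : r = Nat.card {i : Fin g // ∃ m : ℕ, 0 < m ∧ b i ^ m = 1}) :
    {pq : Polynomial ℂ × Polynomial ℂ |
      IsConvergent f pq.1 pq.2 ∧ pq.2.Monic ∧
        (((pq.2.natDegree : ℤ) + r + 2 : ℤ) : WithTop ℤ) ≤
          ordE (emb pq.1 - emb pq.2 * f)}.Finite := by
  classical
  have hβ1 : ∀ i, b i * (ρ i - β i) = 1 := fun i => by
    rw [hbdef]
    linear_combination -hβ i
  have hb0 : ∀ i, b i ≠ 0 := fun i => left_ne_zero_of_mul_eq_one (hβ1 i)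
  have hbρ : ∀ i, (b i + (b i)⁻¹) / 2 = ρ i := fun i => by
    rw [← eq_inv_of_mul_eq_one_right (hβ1 i), hbdef, add_add_sub_cancel, add_self_div_two]
  have hD₁m : D₁.Monic := hD₁ ▸ Polynomial.monic_prod_X_sub_C ρ _
  have hD₁d : D₁.natDegree = g := by
    rw [hD₁, Polynomial.natDegree_finsetProd_X_sub_C_eq_card, Finset.card_univ, Fintype.card_fin]
  have hD₁ρ : ∀ i, D₁.eval (ρ i) = 0 := fun i => by
    rw [hD₁, Polynomial.eval_prod, Finset.prod_eq_zero (Finset.mem_univ i) (by simp)]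
  have hXm : (Polynomial.X ^ 2 - 1 : Polynomial ℂ).Monic :=
    Polynomial.monic_X_pow_sub_C 1 two_ne_zero
  have hXd : (Polynomial.X ^ 2 - 1 : Polynomial ℂ).natDegree = 2 :=
    Polynomial.natDegree_X_pow_sub_C (r := 1)
  have hDm : D.Monic := hD ▸ hXm.mul (hD₁m.pow 2)
  have hDd : D.natDegree = 2 * d := by
    rw [hD, hXm.natDegree_mul (hD₁m.pow 2), hD₁m.natDegree_pow, hXd, hD₁d, hd]
    ring
  obtain ⟨s, ⟨e⟩⟩ :=
    Finite.exists_equiv_fin {i : Fin g // ¬ ∃ m : ℕ, 0 < m ∧ b i ^ m = 1}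
  have hrs : r + s = g := by
    have h1 := Nat.card_congr (Equiv.sumCompl fun i : Fin g => ∃ m : ℕ, 0 < m ∧ b i ^ m = 1)
    rwa [Nat.card_sum, ← hr, Nat.card_congr e, Nat.card_fin, Nat.card_fin] at h1
  have hfin := finite_setOf_exists_polynomial_eval_inv (fun i => b (e.symm i)) (fun i => hb0 _)
    (fun i j h => e.symm.injective (Subtype.ext (hbinj h))) (fun i j => hbInv _ _)
    fun i m hm h => (e.symm i).2 ⟨m, hm, h⟩
  refine Set.Finite.of_finite_image (f := fun pq => pq.2.natDegree)
    ((hfin.preimage (add_left_injective (r + 2)).injOn).subset ?_) ?_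
  · rintro _ ⟨⟨p, q⟩, ⟨hconv, hqm, ho⟩, rfl⟩
    dsimp only at hconv hqm ho ⊢
    rw [ordE_eq_orderTop] at ho
    have hN : p ^ 2 - (Polynomial.X ^ 2 - 1) * (q * D₁) ^ 2 = p ^ 2 - D * q ^ 2 := by
      rw [hD]
      ring
    have hN0 : p ^ 2 - D * q ^ 2 ≠ 0 :=
      hN ▸ sq_sub_X_sq_sub_one_mul_sq_ne_zero (mul_ne_zero hconv.1 hD₁m.ne_zero)
    obtain ⟨hpd, hNd⟩ := natDegree_of_le_orderTop_sub (δ := r + 2) hf2 hDm.ne_zero hDd hconv.1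
      (by push_cast; rwa [← add_assoc]) (by lia) hN0
    have hQd : (q * D₁).natDegree = q.natDegree + g := by
      rw [hqm.natDegree_mul hD₁m, hD₁d]
    obtain ⟨Q, hQ, hlead⟩ : ∃ Q, (Q = q * D₁ ∨ Q = -(q * D₁)) ∧
        p.coeff p.natDegree + Q.coeff (p.natDegree - 1) ≠ 0 := by
      by_contra! h
      have h1 := h _ (Or.inl rfl)
      have h2 := h _ (Or.inr rfl)
      rw [Polynomial.coeff_neg] at h2
      have h3 : p.coeff p.natDegree = 0 := by linear_combination (h1 + h2) / 2
      have hp : p = 0 := by simpa using h3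
      rw [hp, Polynomial.natDegree_zero] at hpd
      lia
    have hQ2 : Q ^ 2 = (q * D₁) ^ 2 := by
      rcases hQ with rfl | rfl
      · rfl
      · exact neg_sq _
    have hQd' : Q.natDegree = q.natDegree + g := by
      rcases hQ with rfl | rfl
      · exact hQd
      · rw [Polynomial.natDegree_neg, hQd]
    have hQρ : ∀ i, Q.eval (ρ i) = 0 := fun i => by
      rcases hQ with rfl | rfl <;> simp [hD₁ρ]
    obtain ⟨W, hW0, hWd, hW⟩ := exists_eval_mul_pow_eq_eval_inv (k := s - 1) (by lia) le_rfl
      (by lia) (hQ2 ▸ hN) hN0 (by lia) (by lia) hlead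
    have hexp : p.natDegree - (s - 1) = q.natDegree + (r + 2) := by lia
    rw [hexp] at hW
    exact ⟨W, hW0, by lia, fun i => hW _ (hb0 _) (by rw [hbρ, hQρ])⟩
  · rintro ⟨p, q⟩ ⟨hconv, hqm, -⟩ ⟨p', q'⟩ ⟨hconv', hqm', -⟩ h
    obtain ⟨rfl, rfl⟩ := eq_of_isConvergent_of_natDegree_eq hconv hconv' hqm hqm' h
    rfl
end

section
/- Let ρ_1, …, ρ_g be pairwise distinct complex numbers with ρ_i ≠ ±1, and for each i fix β_i ∈ ℂ with β_i² = ρ_i² − 1 and set b_i = ρ_i + β_i. Set D(t) = (t² − 1) ∏_{i=1}^g (t − ρ_i)². Then the polynomial Pell equation for D is solvable — i.e. there exist polynomials x, y ∈ ℂ[t] with y ≠ 0 and x² − D y² = 1 — if and only if b_i is a root of unity for every i = 1, …, g. (This condition does not depend on the choice of the β_i, since replacing β_i by −β_i replaces b_i by its inverse.) -/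
section ChebyshevPell

open Polynomial Polynomial.Chebyshev

theorem chebyshev_T_add_one_eq (n : ℤ) :
    T ℂ (n + 1) = X * T ℂ n + (X ^ 2 - 1) * U ℂ (n - 1) := by
  have h := T_eq_X_mul_T_sub_pol_U ℂ (n - 1)
  rw [show n - 1 + 2 = n + 1 by ring, show n - 1 + 1 = n by ring] at h
  linear_combination h

theorem chebyshev_U_eq (n : ℤ) : U ℂ n = X * U ℂ (n - 1) + T ℂ n := by
  simpa using U_eq_X_mul_U_add_T ℂ (n - 1)

theorem chebyshev_pell (n : ℕ) :
    T ℂ n ^ 2 - (X ^ 2 - 1) * U ℂ ((n : ℤ) - 1) ^ 2 = 1 := by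
  induction n with
  | zero => simp
  | succ n ih =>
    push_cast
    rw [chebyshev_T_add_one_eq, add_sub_cancel_right, chebyshev_U_eq n]
    linear_combination ih

theorem chebyshev_eval_add_mul_eval {r c : ℂ} (h : c ^ 2 = r ^ 2 - 1) (n : ℕ) :
    (T ℂ n).eval r + c * (U ℂ ((n : ℤ) - 1)).eval r = (r + c) ^ n := by
  induction n with
  | zero => simp
  | succ n ih =>
    push_cast
    rw [chebyshev_T_add_one_eq, add_sub_cancel_right, chebyshev_U_eq n, pow_succ (r + c), ← ih]
    simp only [eval_add, eval_mul, eval_sub, eval_pow, eval_X, eval_one]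
    linear_combination -(U ℂ ((n : ℤ) - 1)).eval r * h

/-- One of the two conjugate factors of a nontrivial solution of the Pell equation for `X ^ 2 - 1`
has degree smaller than the solution. -/
theorem degree_lt_of_pell {x z : ℂ[X]} (hz : z ≠ 0) (h : x ^ 2 - (X ^ 2 - 1) * z ^ 2 = 1) :
    (X * z - x).degree < z.degree ∨ (X * z + x).degree < z.degree := by
  by_contra! hcon
  obtain ⟨h1, h2⟩ := hcon
  have hprod : (X * z - x) * (X * z + x) = z ^ 2 - 1 := by linear_combination -h
  have ha : X * z - x ≠ 0 := fun h0 => hz (by simpa [h0] using h1)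
  have hb : X * z + x ≠ 0 := fun h0 => hz (by simpa [h0] using h2)
  have h1' := natDegree_le_natDegree h1
  have h2' := natDegree_le_natDegree h2
  have hle : (z ^ 2 - 1).natDegree ≤ 2 * z.natDegree := by
    refine (natDegree_sub_le _ _).trans ?_
    simp [natDegree_pow]
  rw [← hprod, natDegree_mul ha hb] at hle
  have hsum : (X * z - x) + (X * z + x) = C 2 * (X * z) := by
    rw [C_ofNat]; ring
  have hdeg : (C (2 : ℂ) * (X * z)).natDegree = z.natDegree + 1 := by
    rw [natDegree_C_mul two_ne_zero, natDegree_X_mul hz]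
  have := natDegree_add_le (X * z - x) (X * z + x)
  rw [hsum, hdeg] at this
  omega

/-- Up to sign, the solutions of the Pell equation for `X ^ 2 - 1` are given by the Chebyshev
polynomials. -/
theorem exists_chebyshev_of_pell {x z : ℂ[X]} (h : x ^ 2 - (X ^ 2 - 1) * z ^ 2 = 1) :
    ∃ (n : ℤ) (s : ℂ[X]), s ^ 2 = 1 ∧ x = s * T ℂ n ∧ z = s * U ℂ (n - 1) := by
  obtain ⟨k, hk⟩ : ∃ k : ℕ, z.degree < k :=
    ⟨z.natDegree + 1, degree_le_natDegree.trans_lt (by exact_mod_cast Nat.lt_succ_self _)⟩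
  induction k generalizing x z with
  | zero =>
    obtain rfl : z = 0 := by
      rw [← degree_eq_bot]
      exact Nat.WithBot.lt_zero_iff.mp (by exact_mod_cast hk)
    exact ⟨0, x, by linear_combination h, by simp, by simp⟩
  | succ k ih =>
    have descent : ∀ {x z : ℂ[X]}, x ^ 2 - (X ^ 2 - 1) * z ^ 2 = 1 → (X * z - x).degree < (k : WithBot ℕ) →
        ∃ (n : ℤ) (s : ℂ[X]), s ^ 2 = 1 ∧ x = s * T ℂ n ∧ z = s * U ℂ (n - 1) := by
      intro x z h hlt
      obtain ⟨n, s, hs, hx, hz⟩ :=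
        ih (x := X * x - (X ^ 2 - 1) * z) (z := X * z - x) (by linear_combination h) hlt
      refine ⟨n + 1, s, hs, ?_, ?_⟩
      · rw [chebyshev_T_add_one_eq]
        linear_combination X * hx + (X ^ 2 - 1) * hz
      · rw [add_sub_cancel_right, chebyshev_U_eq n]
        linear_combination X * hz + hx
    rcases eq_or_ne z 0 with rfl | hz
    · exact ih h (by simp)
    have hle : z.degree ≤ k := by
      rw [degree_eq_natDegree hz] at hk ⊢
      exact_mod_cast Nat.lt_succ_iff.mp (by exact_mod_cast hk)
    rcases degree_lt_of_pell hz h with hlt | hlt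
    · exact descent h (hlt.trans_le hle)
    · obtain ⟨n, s, hs, hx, hz'⟩ := descent (x := x) (z := -z) (by linear_combination h) (by
        rw [show X * -z - x = -(X * z + x) by ring, degree_neg]
        exact hlt.trans_le hle)
      refine ⟨-n, s, hs, by rw [T_neg, hx], ?_⟩
      rw [U_neg_sub_one]
      linear_combination -hz'

/-- A nontrivial solution of the Pell equation for `X ^ 2 - 1` whose second component vanishes at
`r` forces `r + √(r ^ 2 - 1)` to be a root of unity. -/
theorem exists_pow_eq_one_of_pell {x z : ℂ[X]} (h : x ^ 2 - (X ^ 2 - 1) * z ^ 2 = 1) (hz : z ≠ 0)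
    {r c : ℂ} (hc : c ^ 2 = r ^ 2 - 1) (hr : z.eval r = 0) :
    ∃ m : ℕ, 0 < m ∧ (r + c) ^ m = 1 := by
  obtain ⟨n, s, hs, -, hz'⟩ := exists_chebyshev_of_pell h
  have hn : n ≠ 0 := by
    rintro rfl
    simp [hz'] at hz
  have hsr : s.eval r ≠ 0 := by
    intro h0
    simpa [h0] using congrArg (eval r) hs
  have hU : (U ℂ (n - 1)).eval r = 0 := by
    rw [hz', eval_mul] at hr
    exact (mul_eq_zero.mp hr).resolve_left hsr
  have hU' : (U ℂ ((n.natAbs : ℤ) - 1)).eval r = 0 := by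
    rcases Int.natAbs_eq n with hn' | hn'
    · rwa [← hn']
    · rw [show (n.natAbs : ℤ) = -n by omega, U_neg_sub_one, eval_neg, hU, neg_zero]
  refine ⟨n.natAbs * 2, by omega, ?_⟩
  have hp := congrArg (eval r) (chebyshev_pell n.natAbs)
  rw [pow_mul, ← chebyshev_eval_add_mul_eval hc, hU']
  simp only [eval_sub, eval_mul, eval_pow, hU', eval_one] at hp
  linear_combination hp

theorem chebyshev_U_eval_eq_zero {r c : ℂ} (hc : c ^ 2 = r ^ 2 - 1) (hc0 : c ≠ 0) {n : ℕ}
    (h : (r + c) ^ n = 1) : (U ℂ ((n : ℤ) - 1)).eval r = 0 := by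
  have h1 := chebyshev_eval_add_mul_eval hc n
  have h2 := chebyshev_eval_add_mul_eval (r := r) (c := -c) (by rwa [neg_sq]) n
  have h3 : (r + -c) ^ n = 1 := by
    have : (r + c) ^ n * (r + -c) ^ n = 1 := by
      rw [← mul_pow, show (r + c) * (r + -c) = 1 by linear_combination -hc, one_pow]
    rwa [h, one_mul] at this
  have h4 : 2 * c * (U ℂ ((n : ℤ) - 1)).eval r = 0 := by
    linear_combination h1 - h2 + h - h3
  exact (mul_eq_zero.mp h4).resolve_left (mul_ne_zero two_ne_zero hc0)

end ChebyshevPell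


/-- `D(t) = (t² − 1) ∏ (t − ρ_i)²` is Pellian iff each `b_i = ρ_i + √(ρ_i² − 1)` is a
root of unity. -/
theorem stmt12 (g : ℕ) (ρ β b : Fin g → ℂ)
    (hρdist : Function.Injective ρ) (hρ1 : ∀ i, ρ i ≠ 1 ∧ ρ i ≠ -1)
    (hβ : ∀ i, β i ^ 2 = ρ i ^ 2 - 1) (hbdef : ∀ i, b i = ρ i + β i)
    (D : Polynomial ℂ)
    (hD : D = (Polynomial.X ^ 2 - 1) *
      (∏ i, (Polynomial.X - Polynomial.C (ρ i))) ^ 2) :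
    (∃ x y : Polynomial ℂ, y ≠ 0 ∧ x ^ 2 - D * y ^ 2 = 1) ↔
      ∀ i, ∃ m : ℕ, 0 < m ∧ b i ^ m = 1 := by
  have hβ0 : ∀ i, β i ≠ 0 := by
    intro i h0
    have h := hβ i
    have hprod : (ρ i - 1) * (ρ i + 1) = 0 := by rw [h0] at h; linear_combination -h
    rcases mul_eq_zero.mp hprod with h1 | h1
    · exact (hρ1 i).1 (sub_eq_zero.mp h1)
    · exact (hρ1 i).2 (eq_neg_of_add_eq_zero_left h1)
  constructor
  · rintro ⟨x, y, hy, h⟩ i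
    rw [hbdef]
    refine exists_pow_eq_one_of_pell (x := x)
      (z := (∏ j, (Polynomial.X - Polynomial.C (ρ j))) * y) ?_ ?_ (hβ i) ?_
    · rw [hD] at h
      linear_combination h
    · exact mul_ne_zero (Finset.prod_ne_zero_iff.mpr fun j _ => Polynomial.X_sub_C_ne_zero _) hy
    · rw [Polynomial.eval_mul, Polynomial.eval_prod,
        Finset.prod_eq_zero (Finset.mem_univ i) (by simp), zero_mul]
  · intro h
    choose m hm hbm using h
    set N := ∏ i, m i with hN
    have hNpos : 0 < N := Finset.prod_pos fun i _ => hm i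
    have hdvd : (∏ i, (Polynomial.X - Polynomial.C (ρ i))) ∣
        Polynomial.Chebyshev.U ℂ ((N : ℤ) - 1) := by
      refine Fintype.prod_dvd_of_coprime (Polynomial.pairwise_coprime_X_sub_C hρdist) fun i => ?_
      rw [Polynomial.dvd_iff_isRoot]
      refine chebyshev_U_eval_eq_zero (hβ i) (hβ0 i) ?_
      obtain ⟨k, hk⟩ : m i ∣ N := Finset.dvd_prod_of_mem m (Finset.mem_univ i)
      rw [← hbdef, hk, pow_mul, hbm, one_pow]
    obtain ⟨y, hy⟩ := hdvd
    refine ⟨Polynomial.Chebyshev.T ℂ N, y, ?_, ?_⟩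
    · rintro rfl
      rw [mul_zero] at hy
      exact Polynomial.Chebyshev.U_ne_zero ℂ _ (by omega) hy
    · have hpell := chebyshev_pell N
      rw [hy] at hpell
      rw [hD]
      linear_combination hpell
end

section
/- Let ρ_1, …, ρ_g be pairwise distinct complex numbers with ρ_i ≠ ±1, D_1(t) = ∏_{i=1}^g (t − ρ_i), and D(t) = (t² − 1) D_1(t)². Then D is Pellian — i.e. there exist x, y ∈ ℂ[t] with y ≠ 0 and x² − D y² = 1 — if and only if there exists an integer k ≥ 1 such that D_1 divides the Chebyshev polynomial of the second kind U_{k−1}. -/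
open Polynomial in
/-- One step up in the index multiplies `T n + U (n - 1) √(X² - 1)` by `X + √(X² - 1)`. -/
theorem chebyshev_T_add_one_eq_X_mul_T_add (R : Type*) [CommRing R] (n : ℤ) :
    Chebyshev.T R (n + 1) =
      X * Chebyshev.T R n + (X ^ 2 - 1) * Chebyshev.U R (n - 1) := by
  have h := Chebyshev.T_eq_X_mul_T_sub_pol_U R (n - 1)
  rw [show n - 1 + 2 = n + 1 by ring, show n - 1 + 1 = n by ring] at h
  rw [h]
  ring

open Polynomial in
theorem chebyshev_U_eq_X_mul_U_sub_one_add_T (R : Type*) [CommRing R] (n : ℤ) :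
    Chebyshev.U R n = X * Chebyshev.U R (n - 1) + Chebyshev.T R n := by
  have h := Chebyshev.U_eq_X_mul_U_add_T R (n - 1)
  rwa [sub_add_cancel] at h

open Polynomial in
theorem chebyshev_pell_s13 (R : Type*) [CommRing R] (k : ℕ) :
    Chebyshev.T R k ^ 2 - (X ^ 2 - 1) * Chebyshev.U R ((k : ℤ) - 1) ^ 2 = 1 := by
  induction k with
  | zero => simp
  | succ k ih =>
    push_cast
    rw [add_sub_cancel_right, chebyshev_T_add_one_eq_X_mul_T_add,
      chebyshev_U_eq_X_mul_U_sub_one_add_T R (k : ℤ)]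
    linear_combination ih

open Polynomial in
/-- Descent step: multiplying a solution of the Pell equation for `X² - 1` by one of
`X ± √(X² - 1)` lowers the degree of the second component. -/
theorem pell_X_sq_sub_one_degree_lt {R : Type*} [CommRing R] [IsDomain R] [NeZero (2 : R)]
    {x z : R[X]} (hz : z ≠ 0) (h : x ^ 2 - (X ^ 2 - 1) * z ^ 2 = 1) :
    (X * z - x).degree < z.degree ∨ (X * z + x).degree < z.degree := by
  by_contra! hcon
  obtain ⟨ha, hb⟩ := hcon
  have ha0 : X * z - x ≠ 0 := fun h0 => hz (by simpa [h0] using ha)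
  have hb0 : X * z + x ≠ 0 := fun h0 => hz (by simpa [h0] using hb)
  have ha' := natDegree_le_natDegree ha
  have hb' := natDegree_le_natDegree hb
  have hmul : (X * z - x) * (X * z + x) = z ^ 2 - 1 := by linear_combination -h
  have hprod := congrArg natDegree hmul
  rw [natDegree_mul ha0 hb0] at hprod
  have hle : (z ^ 2 - 1).natDegree ≤ 2 * z.natDegree := by
    refine (natDegree_sub_le _ _).trans ?_
    simp [natDegree_pow]
  have hadd : (X * z - x) + (X * z + x) = C 2 * (X * z) := by
    rw [C_ofNat]
    ring
  have hsum := congrArg natDegree hadd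
  rw [natDegree_C_mul two_ne_zero, natDegree_X_mul hz] at hsum
  have := natDegree_add_le (X * z - x) (X * z + x)
  omega

open Polynomial in
/-- The solutions of the Pell equation for `X² - 1` are, up to sign, the pairs of Chebyshev
polynomials. -/
theorem pell_X_sq_sub_one_eq_chebyshev {R : Type*} [CommRing R] [IsDomain R] [NeZero (2 : R)]
    (x z : R[X]) (h : x ^ 2 - (X ^ 2 - 1) * z ^ 2 = 1) :
    ∃ (s : R[X]) (n : ℤ), s ^ 2 = 1 ∧
      x = s * Chebyshev.T R n ∧ z = s * Chebyshev.U R (n - 1) := by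
  induction hd : z.degree using WellFoundedLT.induction generalizing x z with
  | ind d ih =>
    subst hd
    by_cases hz : z = 0
    · subst hz
      exact ⟨x, 0, by simpa using h, by simp, by simp⟩
    rcases pell_X_sq_sub_one_degree_lt hz h with hlt | hlt
    · obtain ⟨s, n, hs, hx, hz'⟩ := ih _ hlt (X * x - (X ^ 2 - 1) * z) (X * z - x)
        (by linear_combination h) rfl
      refine ⟨s, n + 1, hs, ?_, ?_⟩
      · rw [chebyshev_T_add_one_eq_X_mul_T_add]
        linear_combination X * hx + (X ^ 2 - 1) * hz'
      · rw [add_sub_cancel_right, chebyshev_U_eq_X_mul_U_sub_one_add_T]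
        linear_combination hx + X * hz'
    · obtain ⟨s, n, hs, hx, hz'⟩ := ih _ hlt (X * x + (X ^ 2 - 1) * z) (X * z + x)
        (by linear_combination h) rfl
      have hT := chebyshev_T_add_one_eq_X_mul_T_add R (n - 1)
      have hU := chebyshev_U_eq_X_mul_U_sub_one_add_T R (n - 1)
      rw [sub_add_cancel] at hT
      refine ⟨s, n - 1, hs, ?_, ?_⟩
      · linear_combination X * hx - (X ^ 2 - 1) * hz' + s * X * hT - s * (X ^ 2 - 1) * hU
      · linear_combination X * hz' - hx + s * X * hU - s * hT


/-- `D(t) = (t² − 1) D₁(t)²` is Pellian iff `D₁` divides some Chebyshev polynomial of the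
second kind. -/
theorem stmt13 (g : ℕ) (ρ : Fin g → ℂ)
    (hρdist : Function.Injective ρ) (hρ1 : ∀ i, ρ i ≠ 1 ∧ ρ i ≠ -1)
    (D₁ D : Polynomial ℂ)
    (hD₁ : D₁ = ∏ i, (Polynomial.X - Polynomial.C (ρ i)))
    (hD : D = (Polynomial.X ^ 2 - 1) * D₁ ^ 2) :
    (∃ x y : Polynomial ℂ, y ≠ 0 ∧ x ^ 2 - D * y ^ 2 = 1) ↔
      ∃ k : ℕ, 1 ≤ k ∧ D₁ ∣ Polynomial.Chebyshev.U ℂ ((k : ℤ) - 1) := by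
  subst hD
  constructor
  · rintro ⟨x, y, hy, h⟩
    have hD₁0 : D₁ ≠ 0 := by
      rw [hD₁]
      exact Finset.prod_ne_zero_iff.2 fun i _ => Polynomial.X_sub_C_ne_zero _
    obtain ⟨s, n, hs, -, hU⟩ :=
      pell_X_sq_sub_one_eq_chebyshev x (D₁ * y) (by linear_combination h)
    have hn : n ≠ 0 := by
      rintro rfl
      simp [hD₁0, hy] at hU
    have hdvd : D₁ ∣ Polynomial.Chebyshev.U ℂ (n - 1) :=
      ⟨s * y, by linear_combination -s * hU - Polynomial.Chebyshev.U ℂ (n - 1) * hs⟩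
    refine ⟨n.natAbs, Int.natAbs_pos.2 hn, ?_⟩
    rcases Int.natAbs_eq n with h' | h'
    · rwa [← h']
    · rwa [h', Polynomial.Chebyshev.U_neg_sub_one, dvd_neg] at hdvd
  · rintro ⟨k, hk, y, hy⟩
    refine ⟨Polynomial.Chebyshev.T ℂ k, y, ?_, ?_⟩
    · rintro rfl
      exact Polynomial.Chebyshev.U_ne_zero ℂ ((k : ℤ) - 1) (by omega) (by simpa using hy)
    · have h := chebyshev_pell_s13 ℂ k
      rw [hy] at h
      linear_combination h
end

section
/- Let l, p, q be positive integers with p ≤ l − 1, q ≤ l, and set g = p + q. Let ω ∈ ℂ be a primitive 2l-th root of unity and let h ∈ ℂ^× not be a root of unity. Define b_i = ω^i for 1 ≤ i ≤ p and b_i = h ω^{2i} for p + 1 ≤ i ≤ g. Then for all but finitely many positive integers k, setting n = 2lk, there exist z_1, …, z_l ∈ ℂ ∖ {b_1^{±1}, …, b_g^{±1}} such that ∏_{j=1}^l (z_j − b_i)/(z_j − b_i^{−1}) = b_i^{2n} for every i = 1, …, g. In particular, with δ = (b_1², …, b_g²) and W_l defined from these b_i, one has δ^n ∈ W_l for infinitely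 many n. -/
/-- Over a field with a primitive `l`-th root of unity, `X ^ l - w ^ l` splits into `l` linear
factors. -/
theorem exists_forall_pow_sub_pow_eq_prod_sub {K : Type*} [Field K] {l : ℕ} (hl : 0 < l) {ζ : K}
    (hζ : IsPrimitiveRoot ζ l) (w : K) :
    ∃ z : Fin l → K, ∀ x : K, x ^ l - w ^ l = ∏ j, (x - z j) := by
  let e := Finset.equivFinOfCardEq hζ.card_nthRootsFinset
  refine ⟨fun j => (e.symm j : K) * w, fun x => ?_⟩
  rw [hζ.pow_sub_pow_eq_prod_sub_mul x w hl, ← Finset.prod_coe_sort]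
  exact (e.symm.prod_comp (fun μ => x - (μ : K) * w)).symm

/-- If `H` is not a root of unity, some `c` satisfies `B + c = B ^ (4 * k) * (B⁻¹ + c)`, with both
sides nonzero, for `B = H` and for all `B` with `B ^ 2 = 1`. -/
theorem exists_add_eq_pow_mul_inv_add {K : Type*} [Field K] {H : K} (hH0 : H ≠ 0)
    (hH : ∀ m : ℕ, 0 < m → H ^ m ≠ 1) {k : ℕ} (hk : 0 < k) :
    ∃ c : K, ∀ B : K, B ^ 2 = 1 ∨ B = H →
      B + c ≠ 0 ∧ B⁻¹ + c ≠ 0 ∧ B + c = B ^ (4 * k) * (B⁻¹ + c) := by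
  obtain ⟨m, hm⟩ : ∃ m, 4 * k = m + 1 := ⟨4 * k - 1, by omega⟩
  have hm0 : 0 < m := by omega
  have hD : 1 - H ^ (m + 1) ≠ 0 := sub_ne_zero.2 (hH _ m.succ_pos).symm
  have h1 : H - 1 ≠ 0 := sub_ne_zero.2 (by simpa using hH 1 one_pos)
  have h2 : (H - 1) * (H + 1) ≠ 0 := by
    have := sub_ne_zero.2 (hH 2 two_pos)
    rwa [show H ^ 2 - 1 = (H - 1) * (H + 1) by ring] at this
  have h1' : H + 1 ≠ 0 := right_ne_zero_of_mul h2
  have hpos : H ^ m - 1 ≠ 0 := sub_ne_zero.2 (hH m hm0)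
  have hneg : H ^ m + 1 ≠ 0 := fun h0 => hH (m * 2) (by omega) <| by
    rw [pow_mul, eq_neg_of_add_eq_zero_left h0]; ring
  obtain ⟨c, hc⟩ : ∃ c, c * (1 - H ^ (m + 1)) = H ^ m - H :=
    ⟨(H ^ m - H) / (1 - H ^ (m + 1)), div_mul_cancel₀ _ hD⟩
  refine ⟨c, fun B hB => ?_⟩
  rcases hB with hB | rfl
  · have hinv : B⁻¹ = B := inv_eq_of_mul_eq_one_left (by rw [← sq, hB])
    have hpow : B ^ (4 * k) = 1 := by
      rw [show 4 * k = 2 * (2 * k) by ring, pow_mul, hB, one_pow]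
    have hne : B + c ≠ 0 := by
      intro h0
      have hc' : c = -B := eq_neg_of_add_eq_zero_right h0
      subst hc'
      rcases (by simpa using hB : B = 1 ∨ B = -1) with rfl | rfl
      · exact mul_ne_zero h1 hneg (by linear_combination hc)
      · exact mul_ne_zero h1' hpos (by linear_combination -hc)
    exact ⟨hne, by rwa [hinv], by rw [hinv, hpow, one_mul]⟩
  · have hinv : B * B⁻¹ = 1 := mul_inv_cancel₀ hH0
    have hne : B⁻¹ + c ≠ 0 := by
      intro h0
      refine h2 ?_
      rw [eq_neg_of_add_eq_zero_right h0] at hc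
      linear_combination B * hc + (1 - B ^ (m + 1)) * hinv
    have heq : B + c = B ^ (4 * k) * (B⁻¹ + c) := by
      rw [hm]
      linear_combination hc - B ^ m * hinv
    exact ⟨by rw [heq]; exact mul_ne_zero (pow_ne_zero _ hH0) hne, hne, heq⟩

theorem stmt15 (l p q : ℕ) (hl : 1 ≤ l) (hp : 1 ≤ p) (hq : 1 ≤ q)
    (hpl : p ≤ l - 1) (hql : q ≤ l)
    (g : ℕ) (hg : g = p + q)
    (ω : ℂ) (hω : IsPrimitiveRoot ω (2 * l))
    (h : ℂ) (hh0 : h ≠ 0) (hhru : ∀ m : ℕ, 0 < m → h ^ m ≠ 1)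
    (b : Fin g → ℂ)
    (hb : ∀ i : Fin g, b i =
      if (i : ℕ) + 1 ≤ p then ω ^ ((i : ℕ) + 1) else h * ω ^ (2 * ((i : ℕ) + 1))) :
    -- for all but finitely many positive integers k, with n = 2lk there are suitable z's:
    {k : ℕ | 0 < k ∧ ¬∃ z : Fin l → ℂ,
        (∀ j i, z j ≠ b i ∧ z j ≠ (b i)⁻¹) ∧
        ∀ i, ∏ j, (z j - b i) / (z j - (b i)⁻¹) = b i ^ (2 * (2 * l * k))}.Finite ∧
    -- in particular, δ^n ∈ W_l for infinitely many n:
    {n : ℕ | ∃ z : Fin l → ℂ,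
        (∀ j i, z j ≠ b i ∧ z j ≠ (b i)⁻¹) ∧
        ∀ i, ∏ j, (z j - b i) / (z j - (b i)⁻¹) = b i ^ (2 * n)}.Infinite := by
  have hl0 : 0 < l := hl
  have hζ : IsPrimitiveRoot (ω ^ 2) l := hω.pow (by omega) rfl
  have hbl (i : Fin g) : (b i ^ l) ^ 2 = 1 ∨ b i ^ l = h ^ l := by
    rw [hb i]
    split_ifs
    · left
      rw [← pow_mul, ← pow_mul, show ((i : ℕ) + 1) * (l * 2) = (2 * l) * ((i : ℕ) + 1) by ring,
        pow_mul, hω.pow_eq_one, one_pow]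
    · right
      rw [mul_pow, ← pow_mul, show 2 * ((i : ℕ) + 1) * l = (2 * l) * ((i : ℕ) + 1) by ring,
        pow_mul, hω.pow_eq_one, one_pow, mul_one]
  have key (k : ℕ) (hk : 0 < k) : ∃ z : Fin l → ℂ,
      (∀ j i, z j ≠ b i ∧ z j ≠ (b i)⁻¹) ∧
      ∀ i, ∏ j, (z j - b i) / (z j - (b i)⁻¹) = b i ^ (2 * (2 * l * k)) := by
    obtain ⟨c, hc⟩ := exists_add_eq_pow_mul_inv_add (pow_ne_zero l hh0)
      (fun m hm => by rw [← pow_mul]; exact hhru _ (Nat.mul_pos hl0 hm)) hk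
    obtain ⟨w, hw⟩ := IsAlgClosed.exists_pow_nat_eq (-c) hl0
    obtain ⟨z, hz⟩ := exists_forall_pow_sub_pow_eq_prod_sub hl0 hζ w
    simp only [hw, sub_neg_eq_add] at hz
    refine ⟨z, fun j i => ?_, fun i => ?_⟩
    · obtain ⟨h1, h2, -⟩ := hc _ (hbl i)
      rw [← inv_pow] at h2
      rw [hz] at h1 h2
      exact ⟨(sub_ne_zero.1 (Finset.prod_ne_zero_iff.1 h1 j (Finset.mem_univ j))).symm,
        (sub_ne_zero.1 (Finset.prod_ne_zero_iff.1 h2 j (Finset.mem_univ j))).symm⟩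
    · obtain ⟨-, h2, h3⟩ := hc _ (hbl i)
      rw [← inv_pow] at h2 h3
      calc ∏ j, (z j - b i) / (z j - (b i)⁻¹) = ∏ j, (b i - z j) / ((b i)⁻¹ - z j) :=
            Finset.prod_congr rfl fun j _ => by
              rw [← neg_sub (b i), ← neg_sub (b i)⁻¹, neg_div_neg_eq]
        _ = (b i ^ l) ^ (4 * k) := by
          rw [Finset.prod_div_distrib, ← hz, ← hz, h3, mul_div_cancel_right₀ _ h2]
        _ = b i ^ (2 * (2 * l * k)) := by
          rw [← pow_mul]
          ring_nf
  constructor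
  · convert Set.finite_empty
    exact Set.eq_empty_iff_forall_notMem.2 fun k hk => hk.2 (key k hk.1)
  · refine Set.infinite_of_injective_forall_mem (f := fun k : ℕ => 2 * l * (k + 1)) ?_
      fun k => key (k + 1) k.succ_pos
    intro a a' haa
    simpa [hl0.ne'] using haa
end

section
/- Let D(t) = (1/4096)(t² − 1)(4t² − 1)²(16t² + 20t + 13)² ∈ ℂ[t]. Then D is not Pellian: there are no polynomials x, y ∈ ℂ[t] with y ≠ 0 such that x² − D y² = 1. -/
open Polynomial in
lemma degree_lt_or_degree_lt_of_mul_eq_sq_sub_one {p q z : ℂ[X]} (hz : z ≠ 0)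
    (hadd : p + q = 2 * X * z) (hmul : p * q = z ^ 2 - 1) :
    p.degree < z.degree ∨ q.degree < z.degree := by
  by_contra! ⟨hp, hq⟩
  have hp0 : p ≠ 0 := by
    rintro rfl
    exact hz (by simpa using hp)
  have hq0 : q ≠ 0 := by
    rintro rfl
    exact hz (by simpa using hq)
  have hprod : p.natDegree + q.natDegree ≤ 2 * z.natDegree := by
    rw [← natDegree_mul hp0 hq0, hmul]
    exact (natDegree_sub_le _ _).trans (by simp)
  have hsum : z.natDegree + 1 ≤ max p.natDegree q.natDegree := by
    have h2 : (2 * X * z : ℂ[X]).natDegree = z.natDegree + 1 := by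
      rw [show (2 * X * z : ℂ[X]) = C 2 * (X * z) by rw [C_ofNat]; ring,
        natDegree_C_mul two_ne_zero, natDegree_X_mul hz]
    rw [← h2, ← hadd]
    exact natDegree_add_le _ _
  have hp' := natDegree_le_natDegree hp
  have hq' := natDegree_le_natDegree hq
  omega

open Polynomial in
lemma Chebyshev.T_add_one_eq_X_mul_T_add (n : ℤ) :
    Chebyshev.T ℂ (n + 1) =
      X * Chebyshev.T ℂ n + (X ^ 2 - 1) * Chebyshev.U ℂ (n - 1) := by
  have h := Chebyshev.T_eq_X_mul_T_sub_pol_U ℂ (n - 1)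
  rw [show n - 1 + 2 = n + 1 by ring, sub_add_cancel] at h
  rw [h]
  ring

open Polynomial in
lemma Chebyshev.U_eq_X_mul_U_sub_one_add_T (n : ℤ) :
    Chebyshev.U ℂ n = X * Chebyshev.U ℂ (n - 1) + Chebyshev.T ℂ n := by
  have h := Chebyshev.U_eq_X_mul_U_add_T ℂ (n - 1)
  rwa [sub_add_cancel] at h

open Polynomial in
/-- The solutions of the Pell equation for `X ^ 2 - 1` are the pairs of Chebyshev polynomials. -/
theorem Chebyshev.exists_eq_T_U_of_pell (x z : ℂ[X]) (h : x ^ 2 - (X ^ 2 - 1) * z ^ 2 = 1) :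
    ∃ n : ℤ, (x = Chebyshev.T ℂ n ∧ z = Chebyshev.U ℂ (n - 1)) ∨
      (x = -Chebyshev.T ℂ n ∧ z = -Chebyshev.U ℂ (n - 1)) := by
  induction hd : z.degree using WellFoundedLT.induction generalizing x z with
  | ind d ih =>
    subst hd
    by_cases hz : z = 0
    · subst hz
      refine ⟨0, ?_⟩
      have hx : x ^ 2 = 1 := by simpa using h
      simpa using hx
    rcases degree_lt_or_degree_lt_of_mul_eq_sq_sub_one (p := X * z - x) (q := X * z + x) hz
      (by ring) (by linear_combination -h) with hlt | hlt
    · obtain ⟨n, hn⟩ := ih _ hlt (X * x - (X ^ 2 - 1) * z) (X * z - x)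
        (by linear_combination h) rfl
      have hT := Chebyshev.T_add_one_eq_X_mul_T_add n
      have hU := Chebyshev.U_eq_X_mul_U_sub_one_add_T n
      refine ⟨n + 1, ?_⟩
      rw [add_sub_cancel_right, hT, hU]
      refine hn.imp (fun ⟨h1, h2⟩ => ?_) (fun ⟨h1, h2⟩ => ?_)
      · exact ⟨by linear_combination X * h1 + (X ^ 2 - 1) * h2, by linear_combination X * h2 + h1⟩
      · exact ⟨by linear_combination X * h1 + (X ^ 2 - 1) * h2, by linear_combination X * h2 + h1⟩
    · obtain ⟨n, hn⟩ := ih _ hlt (X * x + (X ^ 2 - 1) * z) (X * z + x)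
        (by linear_combination h) rfl
      have hT := Chebyshev.T_add_one_eq_X_mul_T_add (n - 1)
      have hU := Chebyshev.U_eq_X_mul_U_sub_one_add_T (n - 1)
      rw [sub_add_cancel] at hT
      refine ⟨n - 1, ?_⟩
      refine hn.imp (fun ⟨h1, h2⟩ => ?_) (fun ⟨h1, h2⟩ => ?_)
      · exact ⟨by linear_combination X * h1 - (X ^ 2 - 1) * h2 + X * hT - (X ^ 2 - 1) * hU,
          by linear_combination X * h2 - h1 + X * hU - hT⟩
      · exact ⟨by linear_combination X * h1 - (X ^ 2 - 1) * h2 - X * hT + (X ^ 2 - 1) * hU,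
          by linear_combination X * h2 - h1 - X * hU + hT⟩

open Polynomial in
/-- The roots of nonzero Chebyshev polynomials of the second kind are real. -/
theorem Chebyshev.im_eq_zero_of_isRoot_U {n : ℤ} (hn : n ≠ 0) {a : ℂ}
    (ha : (Chebyshev.U ℂ (n - 1)).eval a = 0) : a.im = 0 := by
  obtain ⟨θ, rfl⟩ := Complex.cos_surjective a
  have h := Chebyshev.U_complex_cos θ (n - 1)
  rw [ha, zero_mul] at h
  obtain ⟨k, hk⟩ := Complex.sin_eq_zero_iff.mp h.symm
  have hn' : (n : ℂ) ≠ 0 := Int.cast_ne_zero.mpr hn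
  have hθ : θ = ((k * Real.pi / n : ℝ) : ℂ) := by
    push_cast at hk ⊢
    field_simp
    linear_combination hk
  rw [hθ]
  exact Complex.cos_ofReal_im _


/-- The polynomial `D(t) = (1/4096)(t² − 1)(4t² − 1)²(16t² + 20t + 13)²` is not Pellian. -/
theorem stmt16 :
    ¬∃ x y : Polynomial ℂ, y ≠ 0 ∧
      x ^ 2 - (Polynomial.C (1 / 4096 : ℂ) * (Polynomial.X ^ 2 - 1) *
        (4 * Polynomial.X ^ 2 - 1) ^ 2 *
        (16 * Polynomial.X ^ 2 + 20 * Polynomial.X + 13) ^ 2) * y ^ 2 = 1 := by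
  rintro ⟨x, y, hy, h⟩
  open Polynomial in
  set g : ℂ[X] := C (1 / 64 : ℂ) * ((4 * X ^ 2 - 1) * (16 * X ^ 2 + 20 * X + 13)) with hg
  have hC : (Polynomial.C (1 / 4096 : ℂ)) = Polynomial.C (1 / 64 : ℂ) ^ 2 := by
    rw [← Polynomial.C_pow]
    norm_num
  obtain ⟨n, hn⟩ := Chebyshev.exists_eq_T_U_of_pell x (g * y) (by
    rw [hC] at h
    rw [hg]
    linear_combination h)
  obtain ⟨a, ha, ha'⟩ : ∃ a : ℂ, 16 * a ^ 2 + 20 * a + 13 = 0 ∧ a.im ≠ 0 := by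
    refine ⟨⟨-5 / 8, 3 * √3 / 8⟩, ?_, by simp⟩
    have h3 : √3 * √3 = (3 : ℝ) := Real.mul_self_sqrt (by norm_num)
    apply Complex.ext <;> simp [pow_two] <;> linarith
  have hroot : (Polynomial.Chebyshev.U ℂ (n - 1)).eval a = 0 := by
    have hga : (g * y).eval a = 0 := by simp [hg, ha]
    rcases hn with ⟨-, hU⟩ | ⟨-, hU⟩ <;> simpa [hU] using hga
  have hn0 : n ≠ 0 := by
    rintro rfl
    have hgy : g * y = 0 := by simpa using hn.imp And.right And.right
    have hg0 : g ≠ 0 := by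
      intro h0
      have := congrArg (Polynomial.eval 0) h0
      norm_num [hg] at this
    exact (mul_ne_zero hg0 hy) hgy
  exact ha' (Chebyshev.im_eq_zero_of_isRoot_U hn0 hroot)
end

section
/- Let n ≥ 1 and 0 ≤ l ≤ g. Then the following two conditions hold simultaneously: (a) δ^n ∈ W_l ∖ W_{l−1} and δ^{n−1} ∉ W_{l−1}; if and only if (b) there exists a convergent (p, q) of f such that deg p = n, ord(p − q f) = deg q + d − l, and p is coprime to D_1. -/
/-- The map `r_b` on `ℂ ∪ {∞}` (modelled as `Option ℂ`, with `none = ∞`). -/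
noncomputable def rr (b : ℂ) : Option ℂ → ℂ :=
  fun z => z.elim 1 (fun w => (w - b) / (w - b⁻¹))

/-- A point of `ℂ ∪ {∞}` avoids all the `b_i^{±1}`. -/
def Allowed {g : ℕ} (b : Fin g → ℂ) (w : Option ℂ) : Prop :=
  ∀ i, w ≠ some (b i) ∧ w ≠ some (b i)⁻¹

/-- `F_k(b, z)`: `F_0(b, z) = b/(b − z)` and `F_{k+1}(b, z) = b ⬝ ∂F_k/∂b (b, z)`. -/
noncomputable def FF : ℕ → ℂ → ℂ → ℂ
  | 0, bb, z => bb / (bb - z)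
  | (k + 1), bb, z => bb * deriv (fun w => FF k w z) bb

/-- `F_k(b, ·)` extended to `ℂ ∪ {∞}` by the convention `F_k(b, ∞) = 0`. -/
noncomputable def FFo (k : ℕ) (bb : ℂ) : Option ℂ → ℂ :=
  fun z => z.elim 0 (fun w => FF k bb w)

/-- The set `W_l` in `(ℂ^×)^g × ∏_i ℂ^{e_i − 1}` of the non-squarefree case (`l : ℤ`,
empty for negative `l`): multiplicative coordinates `∏_j r_i(z_j)`, additive coordinates
`Σ_j (F_k(b_i, z_j) + (−1)^k F_k(b_i⁻¹, z_j))` for `0 ≤ k ≤ e_i − 2`. -/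
def Wns {g : ℕ} (b : Fin g → ℂ) (e : Fin g → ℕ) (l : ℤ) :
    Set ((Fin g → ℂ) × ((i : Fin g) → Fin (e i - 1) → ℂ)) :=
  {x | ∃ m : ℕ, (m : ℤ) = l ∧ ∃ z : Fin m → Option ℂ,
    (∀ j, Allowed b (z j)) ∧
    (∀ i, x.1 i = ∏ j, rr (b i) (z j)) ∧
    (∀ i (k : Fin (e i - 1)), x.2 i k =
      ∑ j, (FFo (k : ℕ) (b i) (z j) + (-1 : ℂ) ^ (k : ℕ) * FFo (k : ℕ) ((b i)⁻¹) (z j)))}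

/-- `δ^n`: multiplicative coordinates `b_i^{2n}`, additive coordinate `2n` at each index
`(i, 0)` and `0` at the indices `(i, k)` with `k ≥ 1`. -/
noncomputable def delpow {g : ℕ} (b : Fin g → ℂ) (e : Fin g → ℕ) (n : ℕ) :
    (Fin g → ℂ) × ((i : Fin g) → Fin (e i - 1) → ℂ) :=
  (fun i => b i ^ (2 * n), fun _ k => if (k : ℕ) = 0 then ((2 * n : ℕ) : ℂ) else 0)

open Polynomial Filter Topology

theorem FF_analyticAt (k : ℕ) {z w : ℂ} (h : w ≠ z) : AnalyticAt ℂ (fun w => FF k w z) w := by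
  induction k generalizing w with
  | zero =>
    have : w - z ≠ 0 := sub_ne_zero.2 h
    simp only [FF]
    fun_prop (disch := assumption)
  | succ k ih =>
    simp only [FF]
    exact analyticAt_id.mul (ih h).deriv

theorem FFo_analyticAt (k : ℕ) {z : Option ℂ} {w : ℂ} (h : z ≠ some w) :
    AnalyticAt ℂ (fun w => FFo k w z) w := by
  cases z with
  | none => simpa [FFo] using analyticAt_const
  | some z => exact FF_analyticAt k (by rintro rfl; exact h rfl)

theorem FFo_succ (k : ℕ) (z : Option ℂ) (w : ℂ) :
    FFo (k + 1) w z = w * deriv (fun w => FFo k w z) w := by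
  cases z <;> simp [FFo, FF]

/-- The exponential curve `x ↦ c e^{σ x}`, along which `w d/dw` becomes `σ⁻¹ d/dx`. -/
noncomputable def expCurve (c σ x : ℂ) : ℂ := c * Complex.exp (σ * x)

theorem expCurve_zero (c σ : ℂ) : expCurve c σ 0 = c := by simp [expCurve]

theorem expCurve_analyticAt (c σ x : ℂ) : AnalyticAt ℂ (expCurve c σ) x := by
  unfold expCurve; fun_prop

theorem expCurve_hasDerivAt (c σ x : ℂ) :
    HasDerivAt (expCurve c σ) (σ * expCurve c σ x) x := by
  have h : HasDerivAt (fun y => σ * y) σ x := by simpa using (hasDerivAt_id x).const_mul σ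
  exact (h.cexp.const_mul c).congr_deriv (by unfold expCurve; ring)

theorem expCurve_inv (c x : ℂ) : expCurve c⁻¹ (-1) x = (expCurve c 1 x)⁻¹ := by
  simp [expCurve, Complex.exp_neg, mul_comm]

theorem expCurve_ne_zero {c : ℂ} (hc : c ≠ 0) (σ x : ℂ) : expCurve c σ x ≠ 0 :=
  mul_ne_zero hc (Complex.exp_ne_zero _)

theorem eventually_ne_expCurve {c : ℂ} (σ : ℂ) {x : ℂ} {z : Option ℂ}
    (h : z ≠ some (expCurve c σ x)) : ∀ᶠ y in 𝓝 x, z ≠ some (expCurve c σ y) := by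
  cases z with
  | none => simp
  | some z =>
    have h' : expCurve c σ x ≠ z := by rintro rfl; exact h rfl
    filter_upwards [(expCurve_analyticAt c σ x).continuousAt.eventually_ne h'] with y hy e
    exact hy (Option.some_injective _ e).symm

theorem FFo_expCurve_analyticAt (k : ℕ) {z : Option ℂ} {c σ x : ℂ}
    (h : z ≠ some (expCurve c σ x)) :
    AnalyticAt ℂ (fun y => FFo k (expCurve c σ y) z) x :=
  AnalyticAt.fun_comp (g := fun w => FFo k w z) (FFo_analyticAt k h) (expCurve_analyticAt c σ x)

theorem iteratedDeriv_FFo_expCurve (k : ℕ) {z : Option ℂ} {c σ x : ℂ}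
    (h : z ≠ some (expCurve c σ x)) :
    iteratedDeriv k (fun y => FFo 0 (expCurve c σ y) z) x = σ ^ k * FFo k (expCurve c σ x) z := by
  induction k generalizing x with
  | zero => simp
  | succ k ih =>
    rw [iteratedDeriv_succ]
    have he : iteratedDeriv k (fun y => FFo 0 (expCurve c σ y) z) =ᶠ[𝓝 x]
        fun y => σ ^ k * FFo k (expCurve c σ y) z := by
      filter_upwards [eventually_ne_expCurve σ h] with y hy using ih hy
    rw [he.deriv_eq]
    have hd := (FFo_analyticAt k h).differentiableAt.hasDerivAt
    have := (HasDerivAt.comp x hd (expCurve_hasDerivAt c σ x)).const_mul (σ ^ k)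
    rw [FFo_succ]
    refine this.deriv.trans ?_
    ring

theorem natCast_le_analyticOrderAt_sub_one_iff {φ A : ℂ → ℂ} {e : ℕ} (he : 1 ≤ e)
    (hφ : AnalyticAt ℂ φ 0) (hA : AnalyticAt ℂ A 0) (h0 : φ 0 ≠ 0)
    (hd : deriv φ =ᶠ[𝓝 0] φ * A) :
    (e : ℕ∞) ≤ analyticOrderAt (fun x => φ x - 1) 0 ↔
      φ 0 = 1 ∧ ∀ k < e - 1, iteratedDeriv k A 0 = 0 := by
  obtain ⟨m, rfl⟩ := Nat.exists_eq_add_of_le' he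
  by_cases h1 : φ 0 = 1
  · have := hφ.analyticOrderAt_deriv_add_one
    rw [h1, analyticOrderAt_congr hd, analyticOrderAt_mul hφ hA,
      analyticOrderAt_eq_zero.2 (Or.inr h0), zero_add] at this
    rw [← this, ← natCast_le_analyticOrderAt_iff_iteratedDeriv_eq_zero hA]
    simp only [h1, true_and, Nat.add_sub_cancel, Nat.cast_add, Nat.cast_one]
    exact ENat.add_le_add_iff_right ENat.one_ne_top
  · have : analyticOrderAt (fun x => φ x - 1) 0 = 0 :=
      analyticOrderAt_eq_zero.2 (Or.inr (sub_ne_zero.2 h1))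
    simp [this, h1]

theorem natCast_le_analyticOrderAt_eval_iff (q : ℂ[X]) (r : ℂ) (e : ℕ) :
    (e : ℕ∞) ≤ analyticOrderAt (fun x => q.eval x) r ↔ (X - C r) ^ e ∣ q := by
  by_cases hq : q = 0
  · have : analyticOrderAt (fun _ : ℂ => (0 : ℂ)) r = ⊤ := analyticOrderAt_eq_top.2 (by simp)
    simp [hq, this]
  have ho : analyticOrderAt (fun x => q.eval x) r = q.rootMultiplicity r := by
    obtain ⟨s, hs, hn⟩ := Polynomial.exists_eq_pow_rootMultiplicity_mul_and_not_dvd q hq r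
    have han : ∀ p : ℂ[X], AnalyticAt ℂ (fun x => p.eval x) r := fun p =>
      p.differentiable.analyticAt r
    rw [(han q).analyticOrderAt_eq_natCast]
    refine ⟨fun x => s.eval x, han s, fun h => hn (dvd_iff_isRoot.2 h), ?_⟩
    refine Eventually.of_forall fun x => ?_
    conv_lhs => rw [hs]
    simp
  rw [ho, Nat.cast_le, le_rootMultiplicity_iff hq]

/-- The polynomial `1 - z X`, read as `X` for `z = ∞`. -/
noncomputable def linFactor (z : Option ℂ) : ℂ[X] := z.elim X fun w => 1 - C w * X

theorem linFactor_ne_zero (z : Option ℂ) : linFactor z ≠ 0 := by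
  cases z with
  | none => exact X_ne_zero
  | some w => intro h; simpa [linFactor] using congrArg (eval 0) h

theorem linFactor_natDegree_le (z : Option ℂ) : (linFactor z).natDegree ≤ 1 := by
  cases z with
  | none => simp [linFactor]
  | some w => simp only [linFactor, Option.elim]; compute_degree

theorem eval_linFactor_eq_zero_iff {v : ℂ} (hv : v ≠ 0) (z : Option ℂ) :
    (linFactor z).eval v = 0 ↔ z = some v⁻¹ := by
  cases z with
  | none => simpa [linFactor] using hv
  | some w =>
    simp only [linFactor, Option.elim, eval_sub, eval_one, eval_mul, eval_C, eval_X,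
      Option.some.injEq]
    rw [sub_eq_zero, eq_comm, ← one_div, eq_div_iff hv]

theorem eval_derivative_linFactor {v : ℂ} (hv : v ≠ 0) {z : Option ℂ} (hz : z ≠ some v⁻¹) :
    v * (derivative (linFactor z)).eval v = (linFactor z).eval v * (1 - FFo 0 v⁻¹ z) := by
  cases z with
  | none => simp [linFactor, FFo]
  | some w =>
    have h : 1 - w * v ≠ 0 := fun h => hz <| by
      rw [← eval_linFactor_eq_zero_iff hv]; simpa [linFactor] using h
    have h' : v⁻¹ - w ≠ 0 := by
      intro h'; apply h; field_simp at h'; linear_combination h'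
    have h'' : 1 - v * w ≠ 0 := by rwa [mul_comm]
    simp [linFactor, FFo, FF]
    field_simp
    ring

theorem eval_derivative_prod_linFactor {v : ℂ} (hv : v ≠ 0) {m : ℕ} {z : Fin m → Option ℂ}
    (hz : ∀ j, z j ≠ some v⁻¹) (k : ℕ) :
    v * (derivative (X ^ k * ∏ j, linFactor (z j))).eval v =
      (X ^ k * ∏ j, linFactor (z j)).eval v * ((k + m : ℕ) - ∑ j, FFo 0 v⁻¹ (z j)) := by
  induction m with
  | zero => cases k <;> simp; ring
  | succ m ih =>
    have h1 := ih (z := fun j => z j.succ) fun j => hz _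
    have h2 := eval_derivative_linFactor hv (hz 0)
    have h3 : X ^ k * ∏ j, linFactor (z j) =
        linFactor (z 0) * (X ^ k * ∏ j : Fin m, linFactor (z j.succ)) := by
      rw [Fin.prod_univ_succ]; ring
    rw [h3, Fin.sum_univ_succ, derivative_mul, eval_add, eval_mul (p := linFactor (z 0)),
      eval_mul (p := derivative _), eval_mul (p := linFactor (z 0))]
    push_cast at h1 ⊢
    linear_combination (eval v (X ^ k * ∏ j : Fin m, linFactor (z j.succ))) * h2 +
      eval v (linFactor (z 0)) * h1

theorem eval_linFactor_div {c : ℂ} (hc : c ≠ 0) {z : Option ℂ} (hz : z ≠ some c⁻¹) :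
    (linFactor z).eval c⁻¹ / (linFactor z).eval c = (c ^ 2)⁻¹ * rr c z := by
  cases z with
  | none => simp [linFactor, rr]; field_simp
  | some w =>
    have h : 1 - w * c ≠ 0 := fun h => hz <| by
      rw [← eval_linFactor_eq_zero_iff hc]; simpa [linFactor] using h
    have h' : w - c⁻¹ ≠ 0 := by
      intro h'; apply h; field_simp at h'; linear_combination -h'
    have h'' : w * c - 1 ≠ 0 := by intro h; apply h'; field_simp; simpa using h
    have h3 : 1 - c * w ≠ 0 := by rwa [mul_comm]
    have h4 : c * w - 1 ≠ 0 := by rwa [mul_comm]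
    simp [linFactor, rr]
    field_simp
    ring

/-- `P(t - s) = p(t) - q(t) s` holds whenever `s² = t² - 1`. -/
def IsRep (P p q : ℂ[X]) : Prop :=
  ∀ (A : Type) [CommRing A] [Algebra ℂ A] (t s : A), s ^ 2 = t ^ 2 - 1 →
    aeval (t - s) P = aeval t p - aeval t q * s

theorem IsRep.eval_eq {P p q : ℂ[X]} (h : IsRep P p q) {v : ℂ} (hv : v ≠ 0) :
    P.eval v = p.eval ((v + v⁻¹) / 2) - q.eval ((v + v⁻¹) / 2) * ((v⁻¹ - v) / 2) := by
  have := h ℂ ((v + v⁻¹) / 2) ((v⁻¹ - v) / 2) (by field_simp; ring)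
  rw [show (v + v⁻¹) / 2 - (v⁻¹ - v) / 2 = v by ring] at this
  simpa using this

theorem IsRep.pow_dvd_iff {P p q : ℂ[X]} {m k : ℕ} {z : Fin m → Option ℂ}
    (hP : P = X ^ k * ∏ j, linFactor (z j)) (h : IsRep P p q) {c : ℂ} (hc : c ≠ 0)
    (hc2 : c ≠ c⁻¹) (hz : ∀ j, z j ≠ some c ∧ z j ≠ some c⁻¹) {e : ℕ} (he : 1 ≤ e) :
    (X - C ((c + c⁻¹) / 2)) ^ e ∣ q ↔ c ^ (2 * (k + m)) = ∏ j, rr c (z j) ∧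
      ∀ i < e - 1, (if i = 0 then ((2 * (k + m) : ℕ) : ℂ) else 0) =
        ∑ j, (FFo i c (z j) + (-1) ^ i * FFo i c⁻¹ (z j)) := by
  have hz1 : ∀ j, z j ≠ some (expCurve c 1 0) := fun j => by simpa [expCurve_zero] using (hz j).1
  have hz2 : ∀ j, z j ≠ some (expCurve c⁻¹ (-1) 0) := fun j => by
    simpa [expCurve_zero] using (hz j).2
  set A : ℂ → ℂ := fun x => (∑ j, (FFo 0 (expCurve c 1 x) (z j) +
    FFo 0 (expCurve c⁻¹ (-1) x) (z j))) - ((2 * (k + m) : ℕ) : ℂ) with hAdef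
  set G : ℂ → ℂ := fun x => P.eval (expCurve c⁻¹ (-1) x) with hG
  set H : ℂ → ℂ := fun x => P.eval (expCurve c 1 x) with hH
  have hPne : ∀ v : ℂ, v ≠ 0 → (∀ j, z j ≠ some v⁻¹) → P.eval v ≠ 0 := by
    intro v hv hzv
    rw [hP, eval_mul, eval_prod]
    refine mul_ne_zero (by simp [hv]) (Finset.prod_ne_zero_iff.2 fun j _ => ?_)
    rw [Ne, eval_linFactor_eq_zero_iff hv]; exact hzv j
  have hGa : AnalyticAt ℂ G 0 := AnalyticAt.fun_comp (g := fun v => P.eval v)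
    (P.differentiable.analyticAt _) (expCurve_analyticAt _ _ _)
  have hHa : AnalyticAt ℂ H 0 := AnalyticAt.fun_comp (g := fun v => P.eval v)
    (P.differentiable.analyticAt _) (expCurve_analyticAt _ _ _)
  have hAa : AnalyticAt ℂ A 0 := by
    refine AnalyticAt.sub (Finset.univ.analyticAt_fun_sum fun j _ => ?_) analyticAt_const
    exact (FFo_expCurve_analyticAt 0 (hz1 j)).add (FFo_expCurve_analyticAt 0 (hz2 j))
  have hev : ∀ᶠ x in 𝓝 (0 : ℂ), ∀ j, z j ≠ some (expCurve c 1 x) ∧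
      z j ≠ some (expCurve c⁻¹ (-1) x) := by
    rw [eventually_all]
    exact fun j => (eventually_ne_expCurve 1 (hz1 j)).and (eventually_ne_expCurve (-1) (hz2 j))
  have hH0 : ∀ x, (∀ j, z j ≠ some (expCurve c⁻¹ (-1) x)) → H x ≠ 0 := fun x hx =>
    hPne _ (expCurve_ne_zero hc _ _) (by simpa [expCurve_inv] using hx)
  have hG0 : ∀ x, (∀ j, z j ≠ some (expCurve c 1 x)) → G x ≠ 0 := fun x hx =>
    hPne _ (expCurve_ne_zero (inv_ne_zero hc) _ _) (by simpa [expCurve_inv] using hx)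
  have hderiv : deriv (fun x => G x / H x) =ᶠ[𝓝 0] (fun x => G x / H x) * A := by
    filter_upwards [hev] with x hx
    have hu := expCurve_ne_zero hc 1 x
    have hw := expCurve_ne_zero (inv_ne_zero hc) (-1) x
    have hGd : HasDerivAt G _ x :=
      (P.hasDerivAt (expCurve c⁻¹ (-1) x)).comp x (expCurve_hasDerivAt c⁻¹ (-1) x)
    have hHd : HasDerivAt H _ x :=
      (P.hasDerivAt (expCurve c 1 x)).comp x (expCurve_hasDerivAt c 1 x)
    have e1 := eval_derivative_prod_linFactor hw (z := z)
      (fun j => by simpa [expCurve_inv] using (hx j).1) k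
    have e2 := eval_derivative_prod_linFactor hu (z := z)
      (fun j => by simpa [expCurve_inv] using (hx j).2) k
    rw [← hP] at e1 e2
    have hHx := hH0 x fun j => (hx j).2
    rw [(hGd.fun_div hHd hHx).deriv, Pi.mul_apply]
    have e1' : eval (expCurve c⁻¹ (-1) x) (derivative P) * (-1 * expCurve c⁻¹ (-1) x) =
        -(G x * ((k + m : ℕ) - ∑ j, FFo 0 (expCurve c 1 x) (z j))) := by
      rw [show (expCurve c 1 x) = (expCurve c⁻¹ (-1) x)⁻¹ by simp [expCurve_inv]]
      linear_combination -e1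
    have e2' : eval (expCurve c 1 x) (derivative P) * (1 * expCurve c 1 x) =
        H x * ((k + m : ℕ) - ∑ j, FFo 0 (expCurve c⁻¹ (-1) x) (z j)) := by
      rw [expCurve_inv]
      linear_combination e2
    rw [e1', e2', hAdef]
    simp only [Finset.sum_add_distrib]
    push_cast
    field_simp
    ring
  have hφa : AnalyticAt ℂ (fun x => G x / H x) 0 := hGa.div hHa (hH0 0 hz2)
  have key := natCast_le_analyticOrderAt_sub_one_iff (e := e) he hφa hAa
    (div_ne_zero (hG0 0 hz1) (hH0 0 hz2)) hderiv
  have hφ0 : G 0 / H 0 = (c ^ (2 * (k + m)))⁻¹ * ∏ j, rr c (z j) := by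
    simp only [hG, hH, expCurve_zero, hP, eval_mul, eval_prod, eval_pow, eval_X]
    rw [mul_div_mul_comm, ← Finset.prod_div_distrib,
      Finset.prod_congr rfl fun j _ => eval_linFactor_div hc (hz j).2]
    simp only [Finset.prod_mul_distrib, Finset.prod_const, Finset.card_univ, Fintype.card_fin]
    rw [show c ^ (2 * (k + m)) = c ^ k * c ^ k * (c ^ 2) ^ m by ring, inv_pow, inv_pow]
    field_simp
  have hord : analyticOrderAt (fun x => q.eval x) ((c + c⁻¹) / 2) =
      analyticOrderAt (fun x => G x / H x - 1) 0 := by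
    set τ : ℂ → ℂ := fun x => (expCurve c 1 x + expCurve c⁻¹ (-1) x) / 2 with hτ
    have hτa : AnalyticAt ℂ τ 0 :=
      ((expCurve_analyticAt _ _ _).add (expCurve_analyticAt _ _ _)).div_const
    have hτd : HasDerivAt τ ((c - c⁻¹) / 2) 0 := by
      refine (((expCurve_hasDerivAt c 1 0).add (expCurve_hasDerivAt c⁻¹ (-1) 0)).div_const
        2).congr_deriv ?_
      simp only [expCurve_zero]; ring
    have hτ0 : τ 0 = (c + c⁻¹) / 2 := by simp [hτ, expCurve_zero]
    rw [← hτ0, ← analyticOrderAt_comp_of_deriv_ne_zero hτa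
      (by rw [hτd.deriv]; simpa [sub_eq_zero] using hc2)]
    have hqa : AnalyticAt ℂ ((fun x => q.eval x) ∘ τ) 0 :=
      AnalyticAt.comp (q.differentiable.analyticAt _) hτa
    set S : ℂ → ℂ := fun x => expCurve c⁻¹ (-1) x - expCurve c 1 x with hS
    have hSa : AnalyticAt ℂ S 0 := (expCurve_analyticAt _ _ _).sub (expCurve_analyticAt _ _ _)
    have hS0 : analyticOrderAt S 0 = 0 := analyticOrderAt_eq_zero.2 <| Or.inr <| by
      simpa [hS, expCurve_zero, sub_eq_zero] using hc2.symm
    have hHo : analyticOrderAt H 0 = 0 := analyticOrderAt_eq_zero.2 (Or.inr (hH0 0 hz2))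
    have : ((fun x => q.eval x) ∘ τ) * S =ᶠ[𝓝 0] (fun x => G x / H x - 1) * H := by
      filter_upwards [hev] with x hx
      have hHx := hH0 x fun j => (hx j).2
      have hu := expCurve_ne_zero hc 1 x
      have r1 := h.eval_eq hu
      have r2 := h.eval_eq (inv_ne_zero hu)
      simp only [Pi.mul_apply, Function.comp, sub_mul, div_mul_cancel₀ _ hHx, one_mul]
      simp only [hG, hH, hτ, hS, expCurve_inv]
      rw [inv_inv, add_comm _ (expCurve c 1 x)] at r2
      rw [r1, r2]
      ring
    have := analyticOrderAt_congr this
    rwa [analyticOrderAt_mul hqa hSa, analyticOrderAt_mul (hφa.fun_sub analyticAt_const) hHa, hS0,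
      hHo, add_zero, add_zero] at this
  rw [← natCast_le_analyticOrderAt_eval_iff, hord, key, hφ0]
  refine and_congr ?_ (forall₂_congr fun i _ => ?_)
  · rw [inv_mul_eq_iff_eq_mul₀ (pow_ne_zero _ hc), mul_one, eq_comm]
  · have hc1 : ∀ j, ContDiffAt ℂ i (fun x => FFo 0 (expCurve c 1 x) (z j)) 0 := fun j =>
      (FFo_expCurve_analyticAt 0 (hz1 j)).contDiffAt
    have hc2 : ∀ j, ContDiffAt ℂ i (fun x => FFo 0 (expCurve c⁻¹ (-1) x) (z j)) 0 := fun j =>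
      (FFo_expCurve_analyticAt 0 (hz2 j)).contDiffAt
    rw [hAdef, iteratedDeriv_fun_sub (ContDiffAt.sum fun j _ => (hc1 j).add (hc2 j))
      contDiffAt_const, iteratedDeriv_const, iteratedDeriv_fun_sum fun j _ => (hc1 j).add (hc2 j),
      sub_eq_zero, eq_comm]
    have : ∀ j, iteratedDeriv i (fun x => FFo 0 (expCurve c 1 x) (z j) +
        FFo 0 (expCurve c⁻¹ (-1) x) (z j)) 0 = FFo i c (z j) + (-1) ^ i * FFo i c⁻¹ (z j) := by
      intro j
      rw [iteratedDeriv_fun_add (hc1 j) (hc2 j), iteratedDeriv_FFo_expCurve i (hz1 j),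
        iteratedDeriv_FFo_expCurve i (hz2 j), expCurve_zero, expCurve_zero, one_pow, one_mul]
    simp only [this]

theorem IsRep.add {P p q P' p' q' : ℂ[X]} (h : IsRep P p q) (h' : IsRep P' p' q') :
    IsRep (P + P') (p + p') (q + q') := by
  intro A _ _ t s hs
  rw [map_add, h A t s hs, h' A t s hs, map_add, map_add]
  ring

theorem isRep_C (a : ℂ) : IsRep (C a) (C a) 0 := by
  intro A _ _ t s hs
  simp

theorem IsRep.C_mul {P p q : ℂ[X]} (h : IsRep P p q) (a : ℂ) :
    IsRep (C a * P) (C a * p) (C a * q) := by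
  intro A _ _ t s hs
  rw [map_mul, h A t s hs, map_mul, map_mul]
  simp only [aeval_C]
  ring

theorem IsRep.X_mul {P p q : ℂ[X]} (h : IsRep P p q) :
    IsRep (X * P) (X * p + (X ^ 2 - 1) * q) (p + X * q) := by
  intro A _ _ t s hs
  rw [map_mul, h A t s hs]
  simp only [map_add, map_mul, map_sub, map_pow, aeval_X, map_one]
  linear_combination (aeval t q) * hs

theorem exists_isRep (P : ℂ[X]) : ∃ p q, IsRep P p q := by
  induction P using Polynomial.induction_on with
  | C a => exact ⟨_, _, isRep_C a⟩
  | add P Q hP hQ =>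
    obtain ⟨p, q, h⟩ := hP
    obtain ⟨p', q', h'⟩ := hQ
    exact ⟨_, _, h.add h'⟩
  | monomial k a ih =>
    obtain ⟨p, q, h⟩ := ih
    rw [show C a * X ^ (k + 1) = X * (C a * X ^ k) by ring]
    exact ⟨_, _, h.X_mul⟩

/-- Multiplication of a representation by `t = (V + V⁻¹) / 2`, where `V = t - s`. -/
theorem IsRep.of_X_mul {P p q : ℂ[X]} (h : IsRep (X * P) p q) :
    IsRep (C (1 / 2) * (P + X ^ 2 * P)) (X * p) (X * q) := by
  intro A _ _ t s hs
  have h2 : algebraMap ℂ A (1 / 2) * 2 = 1 := by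
    rw [← map_ofNat (algebraMap ℂ A) 2, ← map_mul]; norm_num
  have h1 := h A t s hs
  simp only [map_mul, map_add, map_pow, aeval_X, aeval_C] at h1 ⊢
  linear_combination t * h1 + (t * (t - s) * aeval (t - s) P) * h2 +
    algebraMap ℂ A (1 / 2) * aeval (t - s) P * hs

theorem exists_isRep_X_mul (q : ℂ[X]) : ∃ P p, IsRep (X * P) p q := by
  have sub_const : ∀ {P p q : ℂ[X]}, IsRep P p q → ∃ P p, IsRep (X * P) p q := by
    intro P p q h
    refine ⟨P.divX, p + C (-P.coeff 0), ?_⟩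
    have := h.add (isRep_C (-P.coeff 0))
    rwa [add_zero, C_neg, show P + -C (P.coeff 0) = X * P.divX by
      nth_rewrite 1 [← X_mul_divX_add P]; ring, ← C_neg] at this
  induction q using Polynomial.induction_on with
  | C a =>
    refine sub_const (P := X * C a) (p := X * C a + (X ^ 2 - 1) * 0) ?_
    simpa using (isRep_C a).X_mul
  | add q q' hq hq' =>
    obtain ⟨P, p, h⟩ := hq
    obtain ⟨P', p', h'⟩ := hq'
    exact sub_const (h.add h')
  | monomial k a ih =>
    obtain ⟨P, p, h⟩ := ih
    rw [show C a * X ^ (k + 1) = X * (C a * X ^ k) by ring]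
    exact sub_const h.of_X_mul

theorem ordE_eq_addVal (x : LaurentSeries ℂ) : ordE x = HahnSeries.addVal ℤ ℂ x := by
  unfold ordE
  split_ifs with h
  · simp [h]
  · rw [HahnSeries.addVal_apply_of_ne h]

section Valuation

local notation "ν" => HahnSeries.addVal ℤ ℂ

theorem addVal_algebraMap {a : ℂ} (ha : a ≠ 0) :
    ν (algebraMap ℂ (LaurentSeries ℂ) a) = 0 := by
  have : algebraMap ℂ (LaurentSeries ℂ) a = HahnSeries.single 0 a := by
    simp [HahnSeries.algebraMap_apply']
  rw [HahnSeries.addVal_apply, this, HahnSeries.orderTop_single ha]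
  rfl

theorem addVal_aeval_nonneg {x : LaurentSeries ℂ} (hx : ν x = 1) (P : ℂ[X]) :
    0 ≤ ν (aeval x P) := by
  have hC : ∀ a : ℂ, 0 ≤ ν (algebraMap ℂ (LaurentSeries ℂ) a) := by
    intro a
    rcases eq_or_ne a 0 with rfl | ha
    · simp
    · rw [addVal_algebraMap ha]
  induction P using Polynomial.induction_on with
  | C a => simpa using hC a
  | add P Q hP hQ => rw [map_add]; exact AddValuation.map_le_add _ hP hQ
  | monomial k a ih =>
    rw [show C a * X ^ (k + 1) = X * (C a * X ^ k) by ring, map_mul, AddValuation.map_mul, aeval_X,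
      hx]
    exact add_nonneg (by decide) ih

theorem addVal_aeval_eq_zero {x : LaurentSeries ℂ} (hx : ν x = 1) {P : ℂ[X]}
    (hP : P.coeff 0 ≠ 0) : ν (aeval x P) = 0 := by
  rw [← X_mul_divX_add P, map_add, map_mul, aeval_X, aeval_C, AddValuation.map_add_eq_of_lt_right,
    addVal_algebraMap hP]
  rw [addVal_algebraMap hP, AddValuation.map_mul, hx]
  calc (0 : WithTop ℤ) < 1 + 0 := by decide
    _ ≤ _ := by gcongr; exact addVal_aeval_nonneg hx _

theorem X_pow_dvd_iff_le_addVal {x : LaurentSeries ℂ} (hx : ν x = 1) (P : ℂ[X]) (k : ℕ) :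
    X ^ k ∣ P ↔ (((k : ℤ)) : WithTop ℤ) ≤ ν (aeval x P) := by
  constructor
  · rintro ⟨R, rfl⟩
    rw [map_mul, map_pow, aeval_X, AddValuation.map_mul, AddValuation.map_pow, hx]
    calc ((k : ℤ) : WithTop ℤ) = k • 1 + 0 := by simp
      _ ≤ _ := by gcongr; exact addVal_aeval_nonneg hx _
  · induction k generalizing P with
    | zero => simp
    | succ k ih =>
      intro h
      have h0 : P.coeff 0 = 0 := by
        by_contra h0
        rw [addVal_aeval_eq_zero hx h0] at h
        have : ((k + 1 : ℕ) : ℤ) ≤ 0 := by exact_mod_cast h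
        omega
      obtain ⟨R, rfl⟩ := X_dvd_iff.2 h0
      rw [pow_succ']
      refine mul_dvd_mul_left _ (ih R ?_)
      rw [map_mul, aeval_X, AddValuation.map_mul, hx] at h
      generalize ν (aeval x R) = y at h
      cases y with
      | top => exact le_top
      | coe y =>
        have : ((k + 1 : ℕ) : ℤ) ≤ 1 + y := by exact_mod_cast h
        have : (k : ℤ) ≤ y := by push_cast at this; omega
        exact_mod_cast this

theorem addVal_aeval_of_neg {x : LaurentSeries ℂ} (hx : ν x = ((-1 : ℤ) : WithTop ℤ)) {P : ℂ[X]}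
    (hP : P ≠ 0) : ν (aeval x P) = ((-(P.natDegree : ℤ) : ℤ) : WithTop ℤ) := by
  have hx0 : x ≠ 0 := by
    rintro rfl
    rw [AddValuation.map_zero] at hx
    exact WithTop.top_ne_coe hx
  let _ := invertibleOfNonzero hx0
  have hinv : ν x⁻¹ = 1 := by
    have h : ν (x⁻¹ * x) = 0 := by rw [inv_mul_cancel₀ hx0, AddValuation.map_one]
    rw [AddValuation.map_mul, hx] at h
    generalize ν x⁻¹ = y at h
    cases y with
    | top => simp at h
    | coe y =>
      have : y + -1 = 0 := by exact_mod_cast h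
      have : y = 1 := by omega
      simp [this]
  have h1 := eval₂_reverse_mul_pow (algebraMap ℂ (LaurentSeries ℂ)) x P
  rw [← aeval_def, ← aeval_def, invOf_eq_inv] at h1
  rw [← h1, AddValuation.map_mul, addVal_aeval_eq_zero hinv
    (by simpa [coeff_zero_reverse] using hP), AddValuation.map_pow, hx, zero_add]
  rw [← WithTop.coe_nsmul]
  simp

theorem addVal_tK : ν tK = ((-1 : ℤ) : WithTop ℤ) := by
  rw [HahnSeries.addVal_apply, tK, HahnSeries.orderTop_single one_ne_zero]

theorem addVal_emb {p : ℂ[X]} (hp : p ≠ 0) :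
    ν (emb p) = ((-(p.natDegree : ℤ) : ℤ) : WithTop ℤ) :=
  addVal_aeval_of_neg addVal_tK hp

theorem emb_ne_zero {p : ℂ[X]} (hp : p ≠ 0) : emb p ≠ 0 := by
  intro h
  have := addVal_emb hp
  rw [h, AddValuation.map_zero] at this
  exact WithTop.top_ne_coe this

theorem eq_zero_of_addVal_emb_pos {p : ℂ[X]} (h : 0 < ν (emb p)) : p = 0 := by
  by_contra hp
  rw [addVal_emb hp] at h
  have : (0 : ℤ) < -(p.natDegree : ℤ) := by exact_mod_cast h
  omega

theorem IsRep.aeval_sub_eq {P p q : ℂ[X]} (h : IsRep P p q) {s : LaurentSeries ℂ}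
    (hs : s ^ 2 = tK ^ 2 - 1) : aeval (tK - s) P = emb p - emb q * s :=
  h _ _ _ hs

theorem IsRep.aeval_add_eq {P p q : ℂ[X]} (h : IsRep P p q) {s : LaurentSeries ℂ}
    (hs : s ^ 2 = tK ^ 2 - 1) : aeval (tK + s) P = emb p + emb q * s := by
  have := h _ tK (-s) ((neg_sq s).trans hs)
  rw [sub_neg_eq_add] at this
  rw [this, emb, emb]
  ring

theorem emb_mul_s18 (p q : ℂ[X]) : emb (p * q) = emb p * emb q := map_mul _ _ _

theorem emb_sub_s18 (p q : ℂ[X]) : emb (p - q) = emb p - emb q := map_sub _ _ _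

theorem eq_coe_of_add_self_eq {x : WithTop ℤ} {a : ℤ} (h : x + x = ((a + a : ℤ) : WithTop ℤ)) :
    x = (a : WithTop ℤ) := by
  cases x with
  | top => exact (WithTop.top_ne_coe h).elim
  | coe x =>
    have : x + x = a + a := by exact_mod_cast h
    rw [show x = a by omega]

theorem natDegree_X_sq_sub_one : (X ^ 2 - 1 : ℂ[X]).natDegree = 2 := by compute_degree!

theorem X_sq_sub_one_ne_zero : (X ^ 2 - 1 : ℂ[X]) ≠ 0 :=
  ne_zero_of_natDegree_gt (n := 0) (by rw [natDegree_X_sq_sub_one]; norm_num)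

theorem emb_X_sq_sub_one : emb (X ^ 2 - 1) = tK ^ 2 - 1 := by simp [emb]

theorem addVal_of_sq_eq {s : LaurentSeries ℂ} (hs : s ^ 2 = tK ^ 2 - 1) :
    ν s = ((-1 : ℤ) : WithTop ℤ) := by
  apply eq_coe_of_add_self_eq
  rw [← AddValuation.map_mul, ← sq, hs, ← emb_X_sq_sub_one, addVal_emb X_sq_sub_one_ne_zero,
    natDegree_X_sq_sub_one]
  rfl

theorem addVal_tK_add {s : LaurentSeries ℂ} (hs : s ^ 2 = tK ^ 2 - 1) (hv : ν (tK - s) = 1) :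
    ν (tK + s) = ((-1 : ℤ) : WithTop ℤ) := by
  have h : ν ((tK - s) * (tK + s)) = 0 := by
    rw [show (tK - s) * (tK + s) = 1 by linear_combination -hs, AddValuation.map_one]
  rw [AddValuation.map_mul, hv] at h
  generalize ν (tK + s) = y at h
  cases y with
  | top => simp at h
  | coe y =>
    have : 1 + y = 0 := by exact_mod_cast h
    rw [show y = -1 by omega]

theorem IsRep.natDegree_eq {P p q : ℂ[X]} (h : IsRep P p q) {s : LaurentSeries ℂ}
    (hs : s ^ 2 = tK ^ 2 - 1) (hv : ν (tK - s) = 1) (hP : 1 ≤ P.natDegree) :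
    p.natDegree = P.natDegree ∧ q ≠ 0 ∧ q.natDegree + 1 = P.natDegree := by
  have hP0 : P ≠ 0 := ne_zero_of_natDegree_gt hP
  have hU := addVal_aeval_of_neg (addVal_tK_add hs hv) hP0
  have hlt : ν (aeval (tK + s) P) < ν (aeval (tK - s) P) := by
    refine lt_of_lt_of_le ?_ (addVal_aeval_nonneg hv P)
    rw [hU]
    have : -(P.natDegree : ℤ) < 0 := by omega
    exact_mod_cast this
  have hp : emb (C 2 * p) = aeval (tK + s) P + aeval (tK - s) P := by
    rw [h.aeval_add_eq hs, h.aeval_sub_eq hs, emb_mul_s18, emb, aeval_C, map_ofNat]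
    ring
  have hq : emb (C 2 * q) * s = aeval (tK + s) P - aeval (tK - s) P := by
    rw [h.aeval_add_eq hs, h.aeval_sub_eq hs, emb_mul_s18, emb, aeval_C, map_ofNat]
    ring
  have hp' := congrArg ν hp
  have hq' := congrArg ν hq
  rw [AddValuation.map_add_eq_of_lt_left _ hlt, hU] at hp'
  rw [AddValuation.map_sub_eq_of_lt_left _ hlt, hU, AddValuation.map_mul, addVal_of_sq_eq hs]
    at hq'
  have hp0 : C 2 * p ≠ 0 := fun h0 => by
    rw [h0] at hp'
    simp only [emb, map_zero, AddValuation.map_zero] at hp'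
    exact WithTop.top_ne_coe hp'
  have hq0 : C 2 * q ≠ 0 := fun h0 => by
    rw [h0] at hq'
    simp only [emb, map_zero, AddValuation.map_zero, top_add] at hq'
    exact WithTop.top_ne_coe hq'
  rw [addVal_emb hp0, natDegree_C_mul two_ne_zero] at hp'
  rw [addVal_emb hq0, natDegree_C_mul two_ne_zero] at hq'
  have h1 : -(p.natDegree : ℤ) = -P.natDegree := by exact_mod_cast hp'
  have h2 : -(q.natDegree : ℤ) + -1 = -P.natDegree := by exact_mod_cast hq'
  exact ⟨by omega, right_ne_zero_of_mul hq0, by omega⟩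

theorem exists_isRep_of_addVal_pos {s : LaurentSeries ℂ} (hs : s ^ 2 = tK ^ 2 - 1)
    (hv : ν (tK - s) = 1) {p q : ℂ[X]} (h : 0 < ν (emb p - emb q * s)) :
    ∃ P, IsRep P p q := by
  obtain ⟨P, p', hP⟩ := exists_isRep_X_mul q
  have hP' : 0 < ν (emb p' - emb q * s) := by
    rw [← hP.aeval_sub_eq hs]
    refine lt_of_lt_of_le ?_ ((X_pow_dvd_iff_le_addVal hv _ 1).1 (by simp))
    decide
  refine ⟨X * P, ?_⟩
  rwa [show p = p' from ?_]
  refine sub_eq_zero.1 (eq_zero_of_addVal_emb_pos ?_)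
  rw [emb_sub_s18, show emb p - emb p' = (emb p - emb q * s) - (emb p' - emb q * s) by ring]
  exact (lt_min h hP').trans_le (AddValuation.map_sub _ _ _)

theorem exists_eq_C_mul_prod_linFactor {m : ℕ} {R : ℂ[X]} (hR : R ≠ 0) (hm : R.natDegree ≤ m) :
    ∃ c ≠ 0, ∃ z : Fin m → Option ℂ, R = C c * ∏ j, linFactor (z j) := by
  induction m generalizing R with
  | zero =>
    rw [eq_C_of_natDegree_le_zero hm] at hR ⊢
    exact ⟨R.coeff 0, fun h => hR (by rw [h, C_0]), Fin.elim0, by simp⟩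
  | succ m ih =>
    rcases Nat.eq_zero_or_pos R.natDegree with h0 | h0
    · obtain ⟨c, hc, z, hz⟩ := ih hR (by omega)
      refine ⟨c, hc, Fin.cons (some 0) z, ?_⟩
      rw [hz, Fin.prod_univ_succ]
      simp [linFactor]
    · obtain ⟨r, hr⟩ := Complex.exists_root (natDegree_pos_iff_degree_pos.1 h0)
      obtain ⟨Q, rfl⟩ := dvd_iff_isRoot.2 hr
      have hQ : Q ≠ 0 := right_ne_zero_of_mul hR
      rw [natDegree_mul (X_sub_C_ne_zero r) hQ, natDegree_X_sub_C] at hm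
      obtain ⟨c, hc, z, hz⟩ := ih hQ (by omega)
      rcases eq_or_ne r 0 with rfl | hr0
      · refine ⟨c, hc, Fin.cons none z, ?_⟩
        rw [hz, Fin.prod_univ_succ]
        simp [linFactor]
        ring
      · refine ⟨-r * c, by simp [hr0, hc], Fin.cons (some r⁻¹) z, ?_⟩
        have : C r * C r⁻¹ = 1 := by rw [← C_mul, mul_inv_cancel₀ hr0, C_1]
        have hl : linFactor (some r⁻¹) = 1 - C r⁻¹ * X := rfl
        rw [hz, Fin.prod_univ_succ]
        simp only [Fin.cons_zero, Fin.cons_succ, hl, C_mul, C_neg]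
        linear_combination (-X * C c * ∏ j, linFactor (z j)) * this

theorem prod_pow_dvd_iff {g : ℕ} {ρ : Fin g → ℂ} (hρ : Function.Injective ρ) (e : Fin g → ℕ)
    (q : ℂ[X]) : ∏ i, (X - C (ρ i)) ^ e i ∣ q ↔ ∀ i, (X - C (ρ i)) ^ e i ∣ q := by
  refine ⟨fun h i => (Finset.dvd_prod_of_mem (fun i => (X - C (ρ i)) ^ e i)
    (Finset.mem_univ i)).trans h, fun h => Finset.prod_dvd_of_coprime ?_ fun i _ => h i⟩
  intro i _ j _ hij
  exact (isCoprime_X_sub_C_of_isUnit_sub (sub_ne_zero.2 (hρ.ne hij)).isUnit).pow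

theorem isCoprime_prod_pow_iff {g : ℕ} {ρ : Fin g → ℂ} {e : Fin g → ℕ} (he : ∀ i, 1 ≤ e i)
    (p : ℂ[X]) : IsCoprime p (∏ i, (X - C (ρ i)) ^ e i) ↔ ∀ i, p.eval (ρ i) ≠ 0 := by
  rw [IsCoprime.prod_right_iff]
  simp only [Finset.mem_univ, forall_const]
  refine forall_congr' fun i => ?_
  rw [IsCoprime.pow_right_iff (he i), isCoprime_comm,
    (irreducible_X_sub_C (ρ i)).coprime_iff_not_dvd, dvd_iff_isRoot, IsRoot]

theorem prod_linFactor_ne_zero {m : ℕ} (z : Fin m → Option ℂ) : ∏ j, linFactor (z j) ≠ 0 :=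
  Finset.prod_ne_zero_iff.2 fun _ _ => linFactor_ne_zero _

theorem natDegree_prod_linFactor_le {m : ℕ} (z : Fin m → Option ℂ) :
    (∏ j, linFactor (z j)).natDegree ≤ m := by
  refine (natDegree_prod_le _ _).trans ?_
  refine (Finset.sum_le_sum fun j _ => linFactor_natDegree_le (z j)).trans ?_
  simp

theorem delpow_mem_Wns_iff {g : ℕ} {ρ b : Fin g → ℂ} {e : Fin g → ℕ} (he : ∀ i, 1 ≤ e i)
    (hρ : Function.Injective ρ) (hb : ∀ i, b i ≠ 0) (hb2 : ∀ i, b i ≠ (b i)⁻¹)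
    (hρb : ∀ i, ρ i = (b i + (b i)⁻¹) / 2) {n m : ℕ} (hmn : m ≤ n) :
    delpow b e n ∈ Wns b e m ↔ ∃ P p q : ℂ[X],
      IsRep P p (q * ∏ i, (X - C (ρ i)) ^ e i) ∧ P ≠ 0 ∧ P.natDegree ≤ n ∧ X ^ (n - m) ∣ P ∧
      IsCoprime p (∏ i, (X - C (ρ i)) ^ e i) := by
  obtain ⟨k, rfl⟩ := Nat.exists_eq_add_of_le' hmn
  have hD0 : ∀ i, (∏ i, (X - C (ρ i)) ^ e i : ℂ[X]).eval (ρ i) = 0 := by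
    intro i
    rw [eval_prod]
    exact Finset.prod_eq_zero (Finset.mem_univ i) (by simp [Nat.one_le_iff_ne_zero.1 (he i)])
  have ev1 : ∀ {P p q : ℂ[X]}, IsRep P p (q * ∏ i, (X - C (ρ i)) ^ e i) → ∀ i,
      P.eval (b i) = p.eval (ρ i) := by
    intro P p q h i
    rw [h.eval_eq (hb i), ← hρb, eval_mul, hD0]; ring
  have ev2 : ∀ {P p q : ℂ[X]}, IsRep P p (q * ∏ i, (X - C (ρ i)) ^ e i) → ∀ i,
      P.eval (b i)⁻¹ = p.eval (ρ i) := by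
    intro P p q h i
    rw [h.eval_eq (inv_ne_zero (hb i)), inv_inv, add_comm, ← hρb, eval_mul, hD0]; ring
  simp only [isCoprime_prod_pow_iff he, Nat.add_sub_cancel_right]
  constructor
  · rintro ⟨m', hm', z, hz, h1, h2⟩
    obtain rfl : m' = m := by exact_mod_cast hm'
    obtain ⟨p, q, h⟩ := exists_isRep (X ^ k * ∏ j, linFactor (z j))
    have hdvd : ∏ i, (X - C (ρ i)) ^ e i ∣ q := by
      rw [prod_pow_dvd_iff hρ]
      intro i
      rw [hρb, h.pow_dvd_iff rfl (hb i) (hb2 i) (fun j => hz j i) (he i)]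
      exact ⟨h1 i, fun j hj => h2 i ⟨j, hj⟩⟩
    obtain ⟨q, rfl⟩ := hdvd
    rw [mul_comm _ q] at h
    refine ⟨X ^ k * ∏ j, linFactor (z j), p, q, h,
      mul_ne_zero (pow_ne_zero _ X_ne_zero) (prod_linFactor_ne_zero z),
      natDegree_mul_le.trans ?_, Dvd.intro _ rfl, fun i => ?_⟩
    · rw [natDegree_X_pow]
      exact Nat.add_le_add_left (natDegree_prod_linFactor_le z) k
    · rw [← ev1 h i, eval_mul, eval_prod]
      refine mul_ne_zero (by simp [hb i]) (Finset.prod_ne_zero_iff.2 fun j _ => ?_)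
      rw [Ne, eval_linFactor_eq_zero_iff (hb i)]
      exact (hz j i).2
  · rintro ⟨P, p, q, h, hP, hdeg, ⟨R, rfl⟩, hev⟩
    have hR : R ≠ 0 := right_ne_zero_of_mul hP
    rw [natDegree_mul (pow_ne_zero _ X_ne_zero) hR, natDegree_X_pow] at hdeg
    obtain ⟨c, hc, z, rfl⟩ := exists_eq_C_mul_prod_linFactor hR (show R.natDegree ≤ m by omega)
    have hz : ∀ j, Allowed b (z j) := by
      intro j i
      have e1 := hev i
      have e2 := hev i
      rw [← ev1 h i, eval_mul, eval_mul, eval_prod] at e1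
      rw [← ev2 h i, eval_mul, eval_mul, eval_prod] at e2
      have e1 := Finset.prod_ne_zero_iff.1 (right_ne_zero_of_mul (right_ne_zero_of_mul e1)) j
        (Finset.mem_univ j)
      have e2 := Finset.prod_ne_zero_iff.1 (right_ne_zero_of_mul (right_ne_zero_of_mul e2)) j
        (Finset.mem_univ j)
      rw [Ne, eval_linFactor_eq_zero_iff (hb i)] at e1
      rw [Ne, eval_linFactor_eq_zero_iff (inv_ne_zero (hb i)), inv_inv] at e2
      exact ⟨e2, e1⟩
    have h' := h.C_mul c⁻¹
    rw [show C c⁻¹ * (X ^ k * (C c * ∏ j, linFactor (z j))) = X ^ k * ∏ j, linFactor (z j) by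
      have : C c⁻¹ * C c = 1 := by rw [← C_mul, inv_mul_cancel₀ hc, C_1]
      linear_combination (X ^ k * ∏ j, linFactor (z j)) * this, ← mul_assoc] at h'
    have key : ∀ i, _ := fun i => (h'.pow_dvd_iff rfl (hb i) (hb2 i) (fun j => hz j i) (he i)).1
      (by rw [← hρb]; exact (prod_pow_dvd_iff hρ e _).1 (dvd_mul_left _ _) i)
    exact ⟨m, rfl, z, hz, fun i => (key i).1, fun i j => (key i).2 j j.2⟩

theorem emb_coeff_neg (p : ℂ[X]) (k : ℕ) : (emb p).coeff (-(k : ℤ)) = p.coeff k := by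
  induction p using Polynomial.induction_on' with
  | add p q hp hq => rw [emb, map_add, coeff_add, HahnSeries.coeff_add]; exact congrArg₂ _ hp hq
  | monomial m a =>
    have : emb (monomial m a) = HahnSeries.single (-(m : ℤ)) a := by
      rw [emb, aeval_monomial, tK, HahnSeries.single_pow, HahnSeries.algebraMap_apply']
      simp
    rw [this, HahnSeries.coeff_single, coeff_monomial]
    simp [eq_comm]

theorem addVal_tK_sub {f s : LaurentSeries ℂ} {D : ℂ[X]} (hD : D.Monic)
    (hs : s ^ 2 = tK ^ 2 - 1) (hf : f = emb D * s)
    (hlead : f.coeff (-((D.natDegree + 1 : ℕ) : ℤ)) = 1) : ν (tK - s) = 1 := by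
  have hcoeff : (emb D * (tK + s)).coeff (-((D.natDegree + 1 : ℕ) : ℤ)) = 2 := by
    have : emb D * (tK + s) = emb (D * X) + f := by
      rw [hf, emb_mul_s18, mul_add, emb, emb, aeval_X]
    rw [this, HahnSeries.coeff_add, hlead, emb_coeff_neg, coeff_mul_X, hD.coeff_natDegree]
    norm_num
  have h1 : ν (emb D * (tK + s)) ≤ ((-((D.natDegree + 1 : ℕ) : ℤ) : ℤ) : WithTop ℤ) := by
    rw [HahnSeries.addVal_apply]
    exact HahnSeries.orderTop_le_of_coeff_ne_zero (by rw [hcoeff]; norm_num)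
  have h2 : ((-1 : ℤ) : WithTop ℤ) ≤ ν (tK + s) :=
    AddValuation.map_le_add _ addVal_tK.ge (addVal_of_sq_eq hs).ge
  have h3 : ν ((tK - s) * (tK + s)) = 0 := by
    rw [show (tK - s) * (tK + s) = 1 by linear_combination -hs, AddValuation.map_one]
  rw [AddValuation.map_mul, addVal_emb hD.ne_zero] at h1
  rw [AddValuation.map_mul] at h3
  generalize ν (tK + s) = y at h1 h2 h3
  generalize ν (tK - s) = x at h3 ⊢
  cases y with
  | top => simp at h3
  | coe y =>
    cases x with
    | top => simp at h3
    | coe x =>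
      have h1 : -(D.natDegree : ℤ) + y ≤ -((D.natDegree + 1 : ℕ) : ℤ) := by exact_mod_cast h1
      have h2 : -1 ≤ y := by exact_mod_cast h2
      have h3 : x + y = 0 := by exact_mod_cast h3
      rw [show x = 1 by omega]
      rfl

theorem exists_convergent {f s : LaurentSeries ℂ} {D : ℂ[X]} (hD : D.Monic)
    (hs : s ^ 2 = tK ^ 2 - 1) (hv : ν (tK - s) = 1) (hf : f = emb D * s) {n l d : ℕ}
    (hd : d = D.natDegree + 1) (hn : 1 ≤ n) (hld : l < d) (hln : l ≤ n) {P p q : ℂ[X]}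
    (h : IsRep P p (q * D)) (hdeg : P.natDegree = n) (hX : X ^ (n - l) ∣ P)
    (hX' : ¬ X ^ (n - l + 1) ∣ P) (hco : IsCoprime p D)
    (hmin : ∀ P' p' q', IsRep P' p' (q' * D) → P' ≠ 0 → P'.natDegree ≤ n - 1 →
      X ^ (n - l + 1) ∣ P' → ¬ IsCoprime p' D) :
    IsConvergent f p q ∧ p.natDegree = n ∧
      ordE (emb p - emb q * f) = (((q.natDegree : ℤ) + d - l : ℤ) : WithTop ℤ) := by
  obtain ⟨hp, hq0, hq⟩ := h.natDegree_eq hs hv (hdeg ▸ hn)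
  have hq0' : q ≠ 0 := left_ne_zero_of_mul hq0
  rw [natDegree_mul hq0' hD.ne_zero, hdeg] at hq
  have heq : ∀ p q : ℂ[X], emb p - emb (q * D) * s = emb p - emb q * f := fun p q => by
    rw [hf, emb_mul_s18]; ring
  have hval : ν (emb p - emb q * f) = ((n - l : ℕ) : ℤ) := by
    rw [X_pow_dvd_iff_le_addVal hv, h.aeval_sub_eq hs, heq] at hX hX'
    generalize ν (emb p - emb q * f) = y at hX hX'
    cases y with
    | top => exact absurd le_top hX'
    | coe y =>
      have h1 : ((n - l : ℕ) : ℤ) ≤ y := by exact_mod_cast hX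
      have h2 : ¬ ((n - l + 1 : ℕ) : ℤ) ≤ y := by exact_mod_cast hX'
      rw [show y = ((n - l : ℕ) : ℤ) by omega]
  have hord : ordE (emb p - emb q * f) = (((q.natDegree : ℤ) + d - l : ℤ) : WithTop ℤ) := by
    rw [ordE_eq_addVal, hval]
    congr 1
    omega
  refine ⟨⟨hq0', ?_, ?_⟩, hp.trans hdeg, hord⟩
  · refine isCoprime_of_irreducible_dvd (fun h0 => hq0' h0.2) ?_
    rintro z hz ⟨p', rfl⟩ ⟨q', rfl⟩
    have hzd := hz.natDegree_pos
    have hp0 : z * p' ≠ 0 := ne_zero_of_natDegree_gt (n := 0) (by omega)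
    have hp0' := right_ne_zero_of_mul hp0
    rw [hdeg, natDegree_mul hz.ne_zero hp0'] at hp
    have hmul : emb (z * p') - emb (z * q') * f = emb z * (emb p' - emb q' * f) := by
      rw [emb_mul_s18, emb_mul_s18]; ring
    have hval' : (((n - l + 1 : ℕ) : ℤ) : WithTop ℤ) ≤ ν (emb p' - emb q' * f) := by
      rw [hmul, AddValuation.map_mul, addVal_emb hz.ne_zero] at hval
      generalize ν (emb p' - emb q' * f) = y at hval
      cases y with
      | top => exact le_top
      | coe y =>
        have : -(z.natDegree : ℤ) + y = ((n - l : ℕ) : ℤ) := by exact_mod_cast hval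
        have : ((n - l + 1 : ℕ) : ℤ) ≤ y := by push_cast; omega
        exact_mod_cast this
    obtain ⟨P', hP'⟩ := exists_isRep_of_addVal_pos hs hv (p := p') (q := q' * D) (by
      rw [heq]
      refine lt_of_lt_of_le ?_ hval'
      exact_mod_cast Nat.succ_pos _)
    refine hmin P' p' q' hP' ?_ ?_ ?_ hco.of_mul_left_right
    · rintro rfl
      have := hP'.aeval_sub_eq hs
      rw [map_zero, heq] at this
      rw [hmul, ← this, mul_zero, AddValuation.map_zero] at hval
      exact WithTop.top_ne_coe hval
    · rcases Nat.eq_zero_or_pos P'.natDegree with h0 | h0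
      · omega
      · have := (hP'.natDegree_eq hs hv h0).1
        omega
    · rwa [X_pow_dvd_iff_le_addVal hv, hP'.aeval_sub_eq hs, heq]
  · rw [hord]
    have : (q.natDegree : ℤ) + 1 ≤ q.natDegree + d - l := by omega
    exact_mod_cast this

theorem exists_isRep_of_convergent {f s : LaurentSeries ℂ} {D : ℂ[X]} (hD : D.Monic)
    (hs : s ^ 2 = tK ^ 2 - 1) (hv : ν (tK - s) = 1) (hf : f = emb D * s) {n l d : ℕ}
    (hd : d = D.natDegree + 1) (hld : l < d) {p q : ℂ[X]}
    (hpq : IsConvergent f p q) (hp : p.natDegree = n)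
    (hord : ordE (emb p - emb q * f) = (((q.natDegree : ℤ) + d - l : ℤ) : WithTop ℤ)) :
    l < n ∧ (∃ P, IsRep P p (q * D) ∧ P ≠ 0 ∧ P.natDegree = n ∧ X ^ (n - l) ∣ P) ∧
      ∀ P' p' q', IsRep P' p' (q' * D) → P' ≠ 0 → P'.natDegree ≤ n → X ^ (n - l) ∣ P' →
        P'.natDegree = n ∧ ¬ X ^ (n - l + 1) ∣ P' := by
  have heq : ∀ p q : ℂ[X], emb p - emb (q * D) * s = emb p - emb q * f := fun p q => by
    rw [hf, emb_mul_s18]; ring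
  have natDegree_pos : ∀ {k : ℕ} {P : ℂ[X]}, 1 ≤ k → X ^ k ∣ P → P ≠ 0 → 1 ≤ P.natDegree := by
    intro k P hk hX hP
    have := natDegree_le_of_dvd hX hP
    rw [natDegree_X_pow] at this
    omega
  have natDegree_mul_D : ∀ {P p q : ℂ[X]}, IsRep P p (q * D) → 1 ≤ P.natDegree →
      p.natDegree = P.natDegree ∧ q ≠ 0 ∧ q.natDegree + d = P.natDegree := by
    intro P p q h hP
    obtain ⟨h1, h2, h3⟩ := h.natDegree_eq hs hv hP
    have hq := left_ne_zero_of_mul h2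
    rw [natDegree_mul hq hD.ne_zero] at h3
    exact ⟨h1, hq, by omega⟩
  obtain ⟨hq0, hcop, -⟩ := hpq
  rw [ordE_eq_addVal] at hord
  have hpos : (((1 : ℕ) : ℤ) : WithTop ℤ) ≤ ν (emb p - emb q * f) := by
    rw [hord]
    have : ((1 : ℕ) : ℤ) ≤ q.natDegree + d - l := by omega
    exact_mod_cast this
  obtain ⟨P, hP⟩ := exists_isRep_of_addVal_pos hs hv (p := p) (q := q * D) (by
    rw [heq]
    exact lt_of_lt_of_le (by decide) hpos)
  have hP0 : P ≠ 0 := by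
    rintro rfl
    have := hP.aeval_sub_eq hs
    rw [map_zero, heq] at this
    rw [← this, AddValuation.map_zero] at hord
    exact WithTop.top_ne_coe hord
  have hPV := hP.aeval_sub_eq hs
  rw [heq] at hPV
  have hX1 : X ^ 1 ∣ P := by rwa [X_pow_dvd_iff_le_addVal hv, hPV]
  obtain ⟨h1, -, h3⟩ := natDegree_mul_D hP (natDegree_pos le_rfl hX1 hP0)
  have hord' : ν (emb p - emb q * f) = (((n - l : ℕ) : ℤ) : WithTop ℤ) := by
    rw [hord]
    congr 1
    omega
  refine ⟨by omega, ⟨P, hP, hP0, by omega, ?_⟩, ?_⟩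
  · rw [X_pow_dvd_iff_le_addVal hv, hPV, hord']
  · intro P' p' q' hP' hP'0 hdeg' hX'
    obtain ⟨h1', hq'0, h3'⟩ := natDegree_mul_D hP' (natDegree_pos (by omega) hX' hP'0)
    have hPV' := hP'.aeval_sub_eq hs
    rw [heq] at hPV'
    rw [X_pow_dvd_iff_le_addVal hv, hPV'] at hX'
    have hcross : p * q' = p' * q := by
      refine sub_eq_zero.1 (eq_zero_of_addVal_emb_pos ?_)
      rw [emb_sub_s18, emb_mul_s18, emb_mul_s18, show emb p * emb q' - emb p' * emb q =
        emb q' * (emb p - emb q * f) - emb q * (emb p' - emb q' * f) by ring]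
      refine lt_of_lt_of_le (lt_min ?_ ?_) (AddValuation.map_sub _ _ _)
      · rw [AddValuation.map_mul, hord', addVal_emb hq'0]
        have : 0 < -(q'.natDegree : ℤ) + ((n - l : ℕ) : ℤ) := by omega
        exact_mod_cast this
      · rw [AddValuation.map_mul, addVal_emb hq0]
        refine lt_of_lt_of_le ?_ (add_le_add_right hX' _)
        have : 0 < -(q.natDegree : ℤ) + ((n - l : ℕ) : ℤ) := by omega
        exact_mod_cast this
    obtain ⟨c, rfl⟩ := hcop.dvd_of_dvd_mul_right (Dvd.intro _ hcross)
    have hp0 : p ≠ 0 := ne_zero_of_natDegree_gt (n := 0) (by omega)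
    obtain rfl : q' = c * q := mul_left_cancel₀ hp0 (by rw [hcross, mul_assoc])
    have hc : c ≠ 0 := left_ne_zero_of_mul hq'0
    rw [natDegree_mul hp0 hc] at h1'
    refine ⟨by omega, ?_⟩
    rw [X_pow_dvd_iff_le_addVal hv, hPV', show emb (p * c) - emb (c * q) * f =
      emb c * (emb p - emb q * f) by rw [emb_mul_s18, emb_mul_s18]; ring, AddValuation.map_mul,
      hord', addVal_emb hc]
    have : ¬ ((n - l + 1 : ℕ) : ℤ) ≤ -(c.natDegree : ℤ) + ((n - l : ℕ) : ℤ) := by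
      push_cast; omega
    exact_mod_cast this

theorem Wns_subset_succ {g : ℕ} (b : Fin g → ℂ) (e : Fin g → ℕ) (m : ℕ) :
    Wns b e m ⊆ Wns b e ((m + 1 : ℕ) : ℤ) := by
  rintro x ⟨m', hm', z, hz, h1, h2⟩
  obtain rfl : m' = m := by exact_mod_cast hm'
  refine ⟨m' + 1, rfl, Fin.cons none z, ?_, ?_, ?_⟩
  · intro j
    refine Fin.cases ?_ (fun j => ?_) j
    · intro i; simp
    · exact hz j
  · intro i
    rw [h1, Fin.prod_univ_succ]
    simp [rr]
  · intro i k
    rw [h2, Fin.sum_univ_succ]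
    simp [FFo]

theorem Wns_mono {g : ℕ} (b : Fin g → ℂ) (e : Fin g → ℕ) :
    Monotone fun m : ℕ => Wns b e (m : ℤ) :=
  monotone_nat_of_le_succ (Wns_subset_succ b e)

theorem notMem_Wns_neg_one {g : ℕ} (b : Fin g → ℂ) (e : Fin g → ℕ)
    (x : (Fin g → ℂ) × ((i : Fin g) → Fin (e i - 1) → ℂ)) : x ∉ Wns b e (-1) := by
  rintro ⟨m, hm, -⟩
  omega

end Valuation

/-- Non-squarefree analogue of the correspondence between powers of `δ` in the `W_l`
and convergents of `√D` whose numerator is coprime to `D₁`. -/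
theorem stmt18 (g : ℕ) (hg : 1 ≤ g) (ρ β b : Fin g → ℂ) (e : Fin g → ℕ)
    (he : ∀ i, 1 ≤ e i)
    (hρdist : Function.Injective ρ) (hρ1 : ∀ i, ρ i ≠ 1 ∧ ρ i ≠ -1)
    (hβ : ∀ i, β i ^ 2 = ρ i ^ 2 - 1) (hbdef : ∀ i, b i = ρ i + β i)
    (hbinj : Function.Injective b) (hbInv : ∀ i j, b i ≠ (b j)⁻¹)
    (D₁ D : Polynomial ℂ)
    (hD₁ : D₁ = ∏ i, (Polynomial.X - Polynomial.C (ρ i)) ^ (e i))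
    (hD : D = (Polynomial.X ^ 2 - 1) * D₁ ^ 2)
    (d : ℕ) (hd : d = (∑ i, e i) + 1)
    (f : LaurentSeries ℂ) (hf2 : f ^ 2 = emb D) (hlead : f.coeff (-(d : ℤ)) = 1)
    (n : ℕ) (hn : 1 ≤ n) (l : ℕ) (hl : l ≤ g) :
    (delpow b e n ∈ Wns b e (l : ℤ) ∧
     delpow b e n ∉ Wns b e ((l : ℤ) - 1) ∧
     delpow b e (n - 1) ∉ Wns b e ((l : ℤ) - 1)) ↔
    (∃ p q : Polynomial ℂ, IsConvergent f p q ∧ p.natDegree = n ∧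
      ordE (emb p - emb q * f) = (((q.natDegree : ℤ) + d - l : ℤ) : WithTop ℤ) ∧
      IsCoprime p D₁) := by
  have hbβ : ∀ i, b i * (ρ i - β i) = 1 := fun i => by
    rw [hbdef]; linear_combination -hβ i
  have hb : ∀ i, b i ≠ 0 := fun i => left_ne_zero_of_mul_eq_one (hbβ i)
  have hρb : ∀ i, ρ i = (b i + (b i)⁻¹) / 2 := fun i => by
    rw [inv_eq_of_mul_eq_one_right (hbβ i), hbdef]; ring
  have hmonic : D₁.Monic := by
    rw [hD₁]; exact monic_prod_of_monic _ _ fun i _ => (monic_X_sub_C _).pow _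
  have hdeg : d = D₁.natDegree + 1 := by
    rw [hd, hD₁, natDegree_prod_of_monic _ _ fun i _ => (monic_X_sub_C _).pow _]
    simp
  have hld : l < d := by
    have : ∑ _i : Fin g, 1 ≤ ∑ i, e i := Finset.sum_le_sum fun i _ => he i
    simp at this
    omega
  have hE := emb_ne_zero hmonic.ne_zero
  obtain ⟨s, hf⟩ : ∃ s, f = emb D₁ * s := ⟨(emb D₁)⁻¹ * f, (mul_inv_cancel_left₀ hE f).symm⟩
  have hs : s ^ 2 = tK ^ 2 - 1 := by
    rw [hf, hD, sq D₁, emb_mul_s18, emb_mul_s18, emb_X_sq_sub_one] at hf2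
    refine mul_left_cancel₀ (mul_ne_zero hE hE) ?_
    linear_combination hf2
  have hv := addVal_tK_sub hmonic hs hf (hdeg ▸ hlead)
  have hmem : ∀ {n m : ℕ}, m ≤ n → _ := fun {n m} (hmn : m ≤ n) =>
    delpow_mem_Wns_iff he hρdist hb (fun i => hbInv i i) hρb hmn
  rw [← hD₁] at hmem
  constructor
  · rintro ⟨h1, h2, h3⟩
    have hln : l ≤ n := by
      by_contra! hnl
      obtain ⟨k, rfl⟩ : ∃ k, l = k + 1 := ⟨l - 1, by omega⟩
      rw [Nat.cast_succ, add_sub_cancel_right] at h2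
      refine h2 (Wns_mono b e (Nat.le_of_lt_succ hnl) ((hmem le_rfl).2 ⟨1, 1, 0, ?_⟩))
      refine ⟨?_, one_ne_zero, by simp, by simp, isCoprime_one_left⟩
      simpa using isRep_C 1
    obtain ⟨P, p, q, hP, hP0, hPn, hX, hco⟩ := (hmem hln).1 h1
    have hX' : ∀ P p q, IsRep P p (q * D₁) → P ≠ 0 → P.natDegree ≤ n → X ^ (n - l + 1) ∣ P →
        ¬ IsCoprime p D₁ := by
      intro P p q hP hP0 hPn hX hco
      rcases Nat.eq_zero_or_pos l with rfl | hl0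
      · have := natDegree_le_of_dvd hX hP0
        rw [natDegree_X_pow] at this
        omega
      · obtain ⟨k, rfl⟩ : ∃ k, l = k + 1 := ⟨l - 1, by omega⟩
        rw [Nat.cast_succ, add_sub_cancel_right] at h2
        refine h2 ((hmem (by omega)).2 ⟨P, p, q, hP, hP0, hPn, ?_, hco⟩)
        rwa [show n - k = n - (k + 1) + 1 by omega]
    have hPdeg : P.natDegree = n := by
      by_contra hne
      rcases Nat.eq_zero_or_pos l with rfl | hl0
      · have := natDegree_le_of_dvd hX hP0
        rw [natDegree_X_pow] at this
        omega
      · obtain ⟨k, rfl⟩ : ∃ k, l = k + 1 := ⟨l - 1, by omega⟩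
        rw [Nat.cast_succ, add_sub_cancel_right] at h3
        refine h3 ((hmem (by omega)).2 ⟨P, p, q, hP, hP0, by omega, ?_, hco⟩)
        rwa [show n - 1 - k = n - (k + 1) by omega]
    obtain ⟨h4, h5, h6⟩ := exists_convergent hmonic hs hv hf hdeg hn hld hln hP hPdeg hX
      (fun h => hX' P p q hP hP0 hPn h hco) hco
      fun P' p' q' hP' hP'0 hdeg' => hX' P' p' q' hP' hP'0 (by omega)
    exact ⟨p, q, h4, h5, h6, hco⟩
  · rintro ⟨p, q, hpq, hp, hord, hco⟩
    obtain ⟨hln, ⟨P, hP, hP0, hPn, hX⟩, huniq⟩ :=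
      exists_isRep_of_convergent hmonic hs hv hf hdeg hld hpq hp hord
    refine ⟨(hmem hln.le).2 ⟨P, p, q, hP, hP0, hPn.le, hX, hco⟩, ?_⟩
    rcases Nat.eq_zero_or_pos l with rfl | hl0
    · exact ⟨notMem_Wns_neg_one b e _, notMem_Wns_neg_one b e _⟩
    · obtain ⟨k, rfl⟩ : ∃ k, l = k + 1 := ⟨l - 1, by omega⟩
      rw [Nat.cast_succ, add_sub_cancel_right, hmem (by omega), hmem (by omega)]
      constructor
      · rintro ⟨P', p', q', hP', hP'0, hdeg', hX', -⟩
        rw [show n - k = n - (k + 1) + 1 by omega] at hX'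
        exact (huniq P' p' q' hP' hP'0 hdeg' ((pow_dvd_pow _ (Nat.le_succ _)).trans hX')).2 hX'
      · rintro ⟨P', p', q', hP', hP'0, hdeg', hX', -⟩
        rw [show n - 1 - k = n - (k + 1) by omega] at hX'
        have := (huniq P' p' q' hP' hP'0 (by omega) hX').1
        omega
end
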